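/- arXiv:1807.05112 — 7 statements merged into one kernel-verified Lean document; each statement's English description precedes it below -/
import Mathlib

section
/- Let X̂^k = (x̂^k_1,…,x̂^k_T) be an arbitrary optimal schedule for P_k (the discrete data-center optimization problem restricted to states that are multiples of 2^k), with k ≥ 0. Then there exists an optimal schedule X* = (x*_1,…,x*_T) for the continuous extension P̄ such that |x̂^k_t − x*_t| < 2^k holds for all t ∈ {1,…,T}. -/
open Finset

noncomputable section

/-- Feasibility of a discrete schedule for time horizon `T` with `m` servers:
`x 0 = 0` and `x t ∈ {0, …, m}` for `t ∈ {1, …, T}`. -/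
def DFeasible (T m : ℕ) (x : ℕ → ℕ) : Prop :=
  x 0 = 0 ∧ ∀ t ∈ Finset.Icc 1 T, x t ≤ m

/-- Cost of a discrete schedule:
`C(X) = ∑_{t=1}^T f_t(x_t) + β ∑_{t=1}^T (x_t - x_{t-1})⁺`. -/
def DCost (T : ℕ) (β : ℝ) (f : ℕ → ℕ → ℝ) (x : ℕ → ℕ) : ℝ :=
  ∑ t ∈ Finset.Icc 1 T, f t (x t)
    + β * ∑ t ∈ Finset.Icc 1 T, max ((x t : ℝ) - (x (t - 1) : ℝ)) 0

/-- Optimality for the problem `P_k`: the schedule is feasible, all its states are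
multiples of `2 ^ k`, and it minimizes the cost among all such schedules. -/
def DOptimalK (T m : ℕ) (β : ℝ) (f : ℕ → ℕ → ℝ) (k : ℕ) (x : ℕ → ℕ) : Prop :=
  DFeasible T m x ∧ (∀ t ∈ Finset.Icc 1 T, 2 ^ k ∣ x t) ∧
    ∀ y : ℕ → ℕ, DFeasible T m y → (∀ t ∈ Finset.Icc 1 T, 2 ^ k ∣ y t) →
      DCost T β f x ≤ DCost T β f y

/-- Linear interpolation of `f : ℕ → ℝ` to real arguments:
`f̄(x) = (⌈x⌉ - x)·f(⌊x⌋) + (x - ⌊x⌋)·f(⌈x⌉)` (and `f̄(x) = f(x)` at integers). -/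
def interp (f : ℕ → ℝ) (x : ℝ) : ℝ :=
  (1 - (x - (⌊x⌋₊ : ℝ))) * f ⌊x⌋₊ + (x - (⌊x⌋₊ : ℝ)) * f (⌊x⌋₊ + 1)

/-- Feasibility of a fractional schedule: `x 0 = 0` and `x t ∈ [0, m]`. -/
def CFeasible (T m : ℕ) (x : ℕ → ℝ) : Prop :=
  x 0 = 0 ∧ ∀ t ∈ Finset.Icc 1 T, x t ∈ Set.Icc (0 : ℝ) m

/-- Cost of a fractional schedule in the continuous extension `P̄`. -/
def CCost (T : ℕ) (β : ℝ) (f : ℕ → ℕ → ℝ) (x : ℕ → ℝ) : ℝ :=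
  ∑ t ∈ Finset.Icc 1 T, interp (f t) (x t)
    + β * ∑ t ∈ Finset.Icc 1 T, max (x t - x (t - 1)) 0

/-- Optimality for the continuous extension `P̄`. -/
def COptimal (T m : ℕ) (β : ℝ) (f : ℕ → ℕ → ℝ) (x : ℕ → ℝ) : Prop :=
  CFeasible T m x ∧ ∀ y : ℕ → ℝ, CFeasible T m y → CCost T β f x ≤ CCost T β f y

/-- The part of `x` lying in the unit interval `[j, j + 1]`, so that `x = ∑ j, lev j x`. -/
def lev (j : ℕ) (x : ℝ) : ℝ := max 0 (min 1 (x - j))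

/-- Feasibility for the problem with one server, with fractional states allowed. -/
def LevelFeasible (T : ℕ) (u : ℕ → ℝ) : Prop :=
  u 0 = 0 ∧ ∀ t ∈ Finset.Icc 1 T, 0 ≤ u t ∧ u t ≤ 1

/-- Cost in the problem with one server, where running at time `t` costs `g t`. -/
def levelCost (T : ℕ) (β : ℝ) (g : ℕ → ℝ) (u : ℕ → ℝ) : ℝ :=
  ∑ t ∈ Finset.Icc 1 T, (g t * u t + β * max (u t - u (t - 1)) 0)

/-- Optimality in the problem with one server. -/
def LevelOptimal (T : ℕ) (β : ℝ) (g : ℕ → ℝ) (u : ℕ → ℝ) : Prop :=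
  LevelFeasible T u ∧ ∀ v, LevelFeasible T v → levelCost T β g u ≤ levelCost T β g v

/-- The forward difference of `f t` at `j`. -/
def increment (f : ℕ → ℕ → ℝ) (j t : ℕ) : ℝ := f t (j + 1) - f t j

/-- The optimal dual variables of the problem with one server, indexed by the time remaining. -/
def dual (T : ℕ) (β : ℝ) (g : ℕ → ℝ) : ℕ → ℝ
  | 0 => 0
  | s + 1 => max 0 (min β (dual T β g s - g (T - s)))

/-- The lazy strategy: switch on or off only when the dual variable is extremal. -/
def LazyOn (T : ℕ) (β : ℝ) (g : ℕ → ℝ) : ℕ → Prop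
  | 0 => False
  | t + 1 => dual T β g (T - t) = β ∨ (0 < dual T β g (T - t) ∧ LazyOn T β g t)

lemma lev_natCast (j n : ℕ) : lev j (n : ℝ) = if j < n then 1 else 0 := by
  unfold lev
  split_ifs with h
  · have : (j : ℝ) + 1 ≤ n := by exact_mod_cast h
    rw [min_eq_left (by linarith), max_eq_right zero_le_one]
  · have : (n : ℝ) ≤ j := by exact_mod_cast not_lt.mp h
    rw [max_eq_left]
    exact (min_le_right _ _).trans (by linarith)

lemma lev_nonneg (j : ℕ) (x : ℝ) : 0 ≤ lev j x := le_max_left _ _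

lemma lev_le_one (j : ℕ) (x : ℝ) : lev j x ≤ 1 := max_le zero_le_one (min_le_left _ _)

lemma lev_mono (j : ℕ) : Monotone (lev j) := fun a b h => by
  unfold lev
  gcongr

lemma lev_zero (j : ℕ) : lev j 0 = 0 := by simpa using lev_natCast j 0

lemma sum_lev (n : ℕ) {x : ℝ} (hx : 0 ≤ x) : ∑ j ∈ range n, lev j x = min x n := by
  induction n with
  | zero => simp [hx]
  | succ n ih =>
    rw [sum_range_succ, ih, lev]
    push_cast
    grind

lemma sum_max_lev_sub (n : ℕ) {x y : ℝ} (hx : 0 ≤ x) (hy : 0 ≤ y) (hxn : x ≤ n) (hyn : y ≤ n) :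
    ∑ j ∈ range n, max (lev j x - lev j y) 0 = max (x - y) 0 := by
  rcases le_total x y with h | h
  · rw [max_eq_right (by linarith)]
    exact sum_eq_zero fun j _ => max_eq_right (by linarith [lev_mono j h])
  · rw [max_eq_left (by linarith)]
    calc ∑ j ∈ range n, max (lev j x - lev j y) 0 = ∑ j ∈ range n, (lev j x - lev j y) :=
          sum_congr rfl fun j _ => max_eq_left (by linarith [lev_mono j h])
      _ = x - y := by
          rw [sum_sub_distrib, sum_lev n hx, sum_lev n hy, min_eq_left hxn, min_eq_left hyn]

lemma interp_natCast (f : ℕ → ℝ) (n : ℕ) : interp f n = f n := by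
  simp [interp]

lemma interp_min (f : ℕ → ℝ) (n : ℕ) {x : ℝ} (hx : 0 ≤ x) :
    interp f (min x n) = f 0 + ∑ j ∈ range n, (f (j + 1) - f j) * lev j x := by
  induction n with
  | zero => simpa [hx] using interp_natCast f 0
  | succ n ih =>
    rw [sum_range_succ, ← add_assoc, ← ih]
    push_cast
    rcases le_total x n with h | h
    · have hl : lev n x = 0 := by
        unfold lev
        grind
      rw [min_eq_left h, min_eq_left (by linarith), hl]
      ring
    · rw [min_eq_right h, interp_natCast]
      rcases le_or_gt ((n : ℝ) + 1) x with h' | h'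
      · have hl : lev n x = 1 := by
          unfold lev
          grind
        have := interp_natCast f (n + 1)
        push_cast at this
        rw [min_eq_right h', this, hl]
        ring
      · have hl : lev n x = x - n := by
          unfold lev
          grind
        have hfl : ⌊x⌋₊ = n := (Nat.floor_eq_iff hx).2 ⟨h, h'⟩
        rw [min_eq_left h'.le, hl, interp, hfl]
        ring

lemma DCost_eq_CCost (T : ℕ) (β : ℝ) (f : ℕ → ℕ → ℝ) (x : ℕ → ℕ) :
    DCost T β f x = CCost T β f (fun t => (x t : ℝ)) := by
  simp [DCost, CCost, interp_natCast]

lemma CFeasible.bounds {T m : ℕ} {x : ℕ → ℝ} (hx : CFeasible T m x) {t : ℕ} (ht : t ≤ T) :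
    0 ≤ x t ∧ x t ≤ m := by
  rcases Nat.eq_zero_or_pos t with rfl | h
  · simp [hx.1]
  · exact hx.2 t (mem_Icc.2 ⟨h, ht⟩)

lemma DFeasible.cast {T m : ℕ} {x : ℕ → ℕ} (hx : DFeasible T m x) :
    CFeasible T m (fun t => (x t : ℝ)) :=
  ⟨by simp [hx.1], fun t ht => ⟨by positivity, Nat.cast_le.2 (hx.2 t ht)⟩⟩

lemma CFeasible.levelFeasible {T m : ℕ} {x : ℕ → ℝ} (hx : CFeasible T m x) (j : ℕ) :
    LevelFeasible T (fun t => lev j (x t)) :=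
  ⟨by simp [hx.1, lev_zero], fun _ _ => ⟨lev_nonneg _ _, lev_le_one _ _⟩⟩

/-- The cost of a schedule splits into the costs of its levels. -/
lemma CCost_eq_sum_levelCost {T m : ℕ} (β : ℝ) (f : ℕ → ℕ → ℝ) {x : ℕ → ℝ}
    (hx : CFeasible T m x) :
    CCost T β f x = ∑ t ∈ Finset.Icc 1 T, f t 0 +
      ∑ j ∈ range m, levelCost T β (increment f j) (fun t => lev j (x t)) := by
  unfold CCost levelCost
  rw [sum_comm, mul_sum, ← sum_add_distrib, ← sum_add_distrib]
  refine sum_congr rfl fun t ht => ?_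
  have h1 := hx.bounds (mem_Icc.1 ht).2
  have h2 := hx.bounds (t := t - 1) (by have := (mem_Icc.1 ht).2; omega)
  have h3 := interp_min (f t) m h1.1
  rw [min_eq_left h1.2] at h3
  rw [h3, ← sum_max_lev_sub m h1.1 h2.1 h1.2 h2.2, sum_add_distrib, mul_sum, add_assoc]
  rfl

/-- A schedule all of whose levels are optimal is optimal. -/
lemma COptimal_of_levelOptimal {T m : ℕ} {β : ℝ} {f : ℕ → ℕ → ℝ} {x : ℕ → ℝ}
    (hx : CFeasible T m x)
    (h : ∀ j < m, LevelOptimal T β (increment f j) (fun t => lev j (x t))) :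
    COptimal T m β f x := by
  refine ⟨hx, fun y hy => ?_⟩
  rw [CCost_eq_sum_levelCost β f hx, CCost_eq_sum_levelCost β f hy]
  gcongr with j hj
  exact (h j (mem_range.1 hj)).2 _ (hy.levelFeasible j)

lemma dual_mem (T : ℕ) {β : ℝ} (hβ : 0 < β) (g : ℕ → ℝ) (s : ℕ) :
    0 ≤ dual T β g s ∧ dual T β g s ≤ β := by
  cases s with
  | zero => exact ⟨le_rfl, hβ.le⟩
  | succ s => exact ⟨le_max_left _ _, max_le hβ.le (min_le_left _ _)⟩

lemma dual_antitone {T : ℕ} {β : ℝ} {g h : ℕ → ℝ} (hgh : ∀ t ∈ Finset.Icc 1 T, g t ≤ h t) {s : ℕ}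
    (hs : s ≤ T) : dual T β h s ≤ dual T β g s := by
  induction s with
  | zero => exact le_rfl
  | succ s ih =>
    have h1 := ih (by omega)
    have h2 := hgh (T - s) (mem_Icc.2 (by omega))
    unfold dual
    gcongr

lemma LazyOn.of_le {T : ℕ} {β : ℝ} (hβ : 0 < β) {g h : ℕ → ℝ}
    (hgh : ∀ t ∈ Finset.Icc 1 T, g t ≤ h t) {t : ℕ} (ht : t ≤ T) (hl : LazyOn T β h t) :
    LazyOn T β g t := by
  induction t with
  | zero => exact hl
  | succ t ih =>
    have h1 := dual_antitone (β := β) hgh (Nat.sub_le T t)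
    have h2 := dual_mem T hβ g (T - t)
    rcases hl with hl | ⟨hl, hl'⟩
    · exact Or.inl (by linarith)
    · exact Or.inr ⟨by linarith, ih (by omega) hl'⟩

/-- The lazy strategy is optimal. -/
lemma levelOptimal_of_lazyOn {T : ℕ} {β : ℝ} (hβ : 0 < β) {g : ℕ → ℝ} {u : ℕ → ℝ}
    (hu : ∀ t ≤ T, (LazyOn T β g t → u t = 1) ∧ (¬ LazyOn T β g t → u t = 0)) :
    LevelOptimal T β g u := by
  have hu0 : u 0 = 0 := (hu 0 (Nat.zero_le _)).2 id
  have hfeas : LevelFeasible T u := by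
    refine ⟨hu0, fun t ht => ?_⟩
    have := hu t (mem_Icc.1 ht).2
    by_cases h : LazyOn T β g t
    · simp [this.1 h]
    · simp [this.2 h]
  have tele : ∀ v : ℕ → ℝ, v 0 = 0 → ∑ t ∈ Finset.Icc 1 T,
      (dual T β g (T - t) * v t - dual T β g (T - (t - 1)) * v (t - 1)) = 0 := by
    intro v hv
    have key : ∀ n ≤ T, ∑ t ∈ Finset.Icc 1 n,
        (dual T β g (T - t) * v t - dual T β g (T - (t - 1)) * v (t - 1)) =
          dual T β g (T - n) * v n := by
      intro n
      induction n with
      | zero => simp [hv]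
      | succ n ih =>
        intro hn
        rw [sum_Icc_succ_top (by omega), ih (by omega)]
        simp
    rw [key T le_rfl]
    simp [dual]
  refine ⟨hfeas, fun v hv => ?_⟩
  suffices h : ∀ t ∈ Finset.Icc 1 T,
      g t * u t + β * max (u t - u (t - 1)) 0
        - (dual T β g (T - t) * u t - dual T β g (T - (t - 1)) * u (t - 1)) ≤
      g t * v t + β * max (v t - v (t - 1)) 0
        - (dual T β g (T - t) * v t - dual T β g (T - (t - 1)) * v (t - 1)) by
    have := sum_le_sum h
    rw [sum_sub_distrib _ (fun t => dual T β g (T - t) * u t - _), tele u hu0,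
      sum_sub_distrib _ (fun t => dual T β g (T - t) * v t - _), tele v hv.1] at this
    simpa only [levelCost, sub_zero] using this
  intro t ht
  obtain ⟨ht1, htT⟩ := mem_Icc.1 ht
  obtain ⟨s, rfl⟩ : ∃ s, t = s + 1 := ⟨t - 1, by omega⟩
  have hv1 := hv.2 _ ht
  simp only [Nat.add_sub_cancel]
  have hD : dual T β g (T - s) = max 0 (min β (dual T β g (T - (s + 1)) - g (s + 1))) := by
    rw [show T - s = T - (s + 1) + 1 by omega, dual, show T - (T - (s + 1)) = s + 1 by omega]
  have hv2 : (dual T β g (T - s)) * (v (s + 1) - v s) ≤ β * max (v (s + 1) - v s) 0 := by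
    have hd := dual_mem T hβ g (T - s)
    exact (mul_le_mul_of_nonneg_left (le_max_left _ _) hd.1).trans
      (mul_le_mul_of_nonneg_right hd.2 (le_max_right _ _))
  have hus := hu (s + 1) htT
  have hus' := hu s (by omega)
  have hd := dual_mem T hβ g (T - s)
  have hL : LazyOn T β g (s + 1) ↔
      dual T β g (T - s) = β ∨ (0 < dual T β g (T - s) ∧ LazyOn T β g s) := Iff.rfl
  rw [hL] at hus
  generalize dual T β g (T - s) = D at *
  generalize dual T β g (T - (s + 1)) = D' at *
  have hs01 : 0 ≤ u s ∧ u s ≤ 1 := by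
    by_cases h : LazyOn T β g s
    · simp [hus'.1 h]
    · simp [hus'.2 h]
  rcases eq_or_lt_of_le hd.2 with h | h
  · have hu1 := hus.1 (Or.inl h)
    have hr : g (s + 1) + D - D' ≤ 0 := by grind
    rw [hu1, max_eq_left (by linarith)]
    subst h
    nlinarith
  · rcases eq_or_lt_of_le hd.1 with h0 | h0
    · have hu1 := hus.2 (by grind)
      have hr : 0 ≤ g (s + 1) + D - D' := by grind
      rw [hu1, max_eq_right (by linarith)]
      subst h0
      nlinarith
    · have hu1 : u (s + 1) = u s := by
        by_cases hl : LazyOn T β g s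
        · rw [hus.1 (Or.inr ⟨h0, hl⟩), hus'.1 hl]
        · rw [hus.2 (by grind), hus'.2 hl]
      have hr : g (s + 1) = D' - D := by grind
      rw [hu1, sub_self, max_self, hr]
      linarith

lemma lt_card_filter_iff {n j : ℕ} (p : ℕ → Prop) [DecidablePred p]
    (hp : ∀ a b, a ≤ b → b < n → p b → p a) (hj : j < n) :
    j < #{i ∈ range n | p i} ↔ p j := by
  constructor
  · intro h
    by_contra hpj
    have : {i ∈ range n | p i} ⊆ range j := fun i hi => by
      rw [mem_filter, mem_range] at hi
      rw [mem_range]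
      by_contra hij
      exact hpj (hp j i (not_lt.1 hij) hi.1 hi.2)
    have := card_le_card this
    rw [card_range] at this
    omega
  · intro h
    have : range (j + 1) ⊆ {i ∈ range n | p i} := fun i hi => by
      rw [mem_range] at hi
      rw [mem_filter, mem_range]
      exact ⟨by omega, hp i j (by omega) hj h⟩
    have := card_le_card this
    rw [card_range] at this
    omega

/-- For monotone weights there is an integral schedule all of whose levels are optimal. -/
lemma exists_levelOptimal (T n : ℕ) {β : ℝ} (hβ : 0 < β) (g : ℕ → ℕ → ℝ)
    (hg : ∀ i j, i ≤ j → j < n → ∀ t ∈ Finset.Icc 1 T, g i t ≤ g j t) :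
    ∃ y : ℕ → ℕ, DFeasible T n y ∧
      ∀ j < n, LevelOptimal T β (g j) (fun t => lev j (y t)) := by
  classical
  refine ⟨fun t => #{i ∈ range n | LazyOn T β (g i) t},
    ⟨card_eq_zero.2 (filter_false_of_mem fun _ _ => id),
    fun t _ => ?_⟩,
    fun j hj => levelOptimal_of_lazyOn hβ fun t ht => ?_⟩
  · simpa using card_filter_le (range n) fun i => LazyOn T β (g i) t
  · have := lt_card_filter_iff (fun i => LazyOn T β (g i) t)
      (fun a b hab hb => LazyOn.of_le hβ (hg a b hab hb) ht) hj
    rw [lev_natCast]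
    exact ⟨fun h => if_pos (this.2 h), fun h => if_neg (mt this.1 h)⟩

/-- The levels of an optimal integral schedule are optimal. -/
lemma levelOptimal_of_DCost_le {T n : ℕ} {β : ℝ} (hβ : 0 < β) {f : ℕ → ℕ → ℝ}
    (hf : ∀ i j, i ≤ j → j < n → ∀ t ∈ Finset.Icc 1 T, increment f i t ≤ increment f j t)
    {x : ℕ → ℕ} (hx : DFeasible T n x)
    (hmin : ∀ y, DFeasible T n y → DCost T β f x ≤ DCost T β f y) {j : ℕ} (hj : j < n) :
    LevelOptimal T β (increment f j) (fun t => lev j (x t)) := by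
  obtain ⟨y, hy, hyopt⟩ := exists_levelOptimal T n hβ (increment f) hf
  have h := hmin y hy
  rw [DCost_eq_CCost, DCost_eq_CCost, CCost_eq_sum_levelCost β f hx.cast,
    CCost_eq_sum_levelCost β f hy.cast, add_le_add_iff_left] at h
  have hle : ∀ i ∈ range n, levelCost T β (increment f i) (fun t => lev i (y t)) ≤
      levelCost T β (increment f i) (fun t => lev i (x t)) := fun i hi =>
    (hyopt i (mem_range.1 hi)).2 _ (hx.cast.levelFeasible i)
  have heq := (sum_eq_sum_iff_of_le hle).1 (le_antisymm (sum_le_sum hle) h) j (mem_range.2 hj)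
  exact ⟨hx.cast.levelFeasible j, fun v hv => heq ▸ (hyopt j hj).2 v hv⟩

lemma LevelOptimal.congr {T : ℕ} {β : ℝ} {g u v : ℕ → ℝ} (hu : LevelOptimal T β g u)
    (huv : ∀ t ≤ T, v t = u t) : LevelOptimal T β g v := by
  refine ⟨⟨by rw [huv 0 (Nat.zero_le _), hu.1.1], fun t ht => ?_⟩, fun w hw => ?_⟩
  · rw [huv t (mem_Icc.1 ht).2]
    exact hu.1.2 t ht
  · refine le_of_eq_of_le (sum_congr rfl fun t ht => ?_) (hu.2 w hw)
    have := (mem_Icc.1 ht).2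
    rw [huv t this, huv (t - 1) (by omega)]

lemma LevelFeasible.sup {T : ℕ} {u v : ℕ → ℝ} (hu : LevelFeasible T u) (hv : LevelFeasible T v) :
    LevelFeasible T (fun t => max (u t) (v t)) :=
  ⟨by simp [hu.1, hv.1], fun t ht =>
    ⟨(hu.2 t ht).1.trans (le_max_left _ _), max_le (hu.2 t ht).2 (hv.2 t ht).2⟩⟩

lemma LevelFeasible.inf {T : ℕ} {u v : ℕ → ℝ} (hu : LevelFeasible T u) (hv : LevelFeasible T v) :
    LevelFeasible T (fun t => min (u t) (v t)) :=
  ⟨by simp [hu.1, hv.1], fun t ht =>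
    ⟨le_min (hu.2 t ht).1 (hv.2 t ht).1, (min_le_left _ _).trans (hu.2 t ht).2⟩⟩

/-- Submodularity of the cost, with the larger weights on the meet. -/
lemma levelCost_sup_add_inf_le {T : ℕ} {β : ℝ} (hβ : 0 < β) {g h : ℕ → ℝ}
    (hgh : ∀ t ∈ Finset.Icc 1 T, g t ≤ h t) (u v : ℕ → ℝ) :
    levelCost T β g (fun t => max (u t) (v t)) + levelCost T β h (fun t => min (u t) (v t)) ≤
      levelCost T β g u + levelCost T β h v := by
  unfold levelCost
  rw [← sum_add_distrib, ← sum_add_distrib]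
  refine sum_le_sum fun t ht => ?_
  have h1 : max (max (u t) (v t) - max (u (t - 1)) (v (t - 1))) 0 +
      max (min (u t) (v t) - min (u (t - 1)) (v (t - 1))) 0 ≤
      max (u t - u (t - 1)) 0 + max (v t - v (t - 1)) 0 := by
    grind
  have h2 := mul_le_mul_of_nonneg_left h1 hβ.le
  have h3 : g t * max (u t) (v t) + h t * min (u t) (v t) ≤ g t * u t + h t * v t := by
    have := hgh t ht
    rcases le_total (u t) (v t) with h | h
    · rw [max_eq_right h, min_eq_left h]
      nlinarith
    · rw [max_eq_left h, min_eq_right h]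
  linarith

lemma LevelOptimal.sup {T : ℕ} {β : ℝ} (hβ : 0 < β) {g h : ℕ → ℝ} {u v : ℕ → ℝ}
    (hgh : ∀ t ∈ Finset.Icc 1 T, g t ≤ h t) (hu : LevelOptimal T β g u)
    (hv : LevelOptimal T β h v) : LevelOptimal T β g (fun t => max (u t) (v t)) :=
  ⟨hu.1.sup hv.1, fun w hw => by
    linarith [levelCost_sup_add_inf_le hβ hgh u v, hv.2 _ (hu.1.inf hv.1), hu.2 w hw]⟩

lemma LevelOptimal.inf {T : ℕ} {β : ℝ} (hβ : 0 < β) {g h : ℕ → ℝ} {u v : ℕ → ℝ}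
    (hgh : ∀ t ∈ Finset.Icc 1 T, g t ≤ h t) (hu : LevelOptimal T β g u)
    (hv : LevelOptimal T β h v) : LevelOptimal T β h (fun t => min (u t) (v t)) :=
  ⟨hu.1.inf hv.1, fun w hw => by
    linarith [levelCost_sup_add_inf_le hβ hgh u v, hu.2 _ (hu.1.sup hv.1), hv.2 w hw]⟩

lemma mul_increment_le_sub {m : ℕ} {f : ℕ → ℝ}
    (hf : ∀ a b : ℕ, a ≤ b → b + 1 ≤ m → f (a + 1) - f a ≤ f (b + 1) - f b)
    {a b : ℕ} (hab : a ≤ b) (s : ℕ) (hs : b + s ≤ m) :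
    s * (f (a + 1) - f a) ≤ f (b + s) - f b := by
  induction s with
  | zero => simp
  | succ s ih =>
    have h1 := ih (by omega)
    have h2 := hf a (b + s) (by omega) (by omega)
    rw [← add_assoc]
    push_cast
    linarith

lemma sub_le_mul_increment {m : ℕ} {f : ℕ → ℝ}
    (hf : ∀ a b : ℕ, a ≤ b → b + 1 ≤ m → f (a + 1) - f a ≤ f (b + 1) - f b)
    {a b : ℕ} (ha : a + 1 ≤ m) (s : ℕ) (hs : b + s ≤ a + 1) :
    f (b + s) - f b ≤ s * (f (a + 1) - f a) := by
  induction s with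
  | zero => simp
  | succ s ih =>
    have h1 := ih (by omega)
    have h2 := hf (b + s) a (by omega) ha
    rw [← add_assoc]
    push_cast
    linarith

lemma DCost_mul (T : ℕ) (β : ℝ) (f : ℕ → ℕ → ℝ) {d : ℕ} (hd : 0 < d) (x : ℕ → ℕ) :
    DCost T β f (fun t => d * x t) = d * DCost T β (fun t i => f t (d * i) / d) x := by
  have hd' : (0 : ℝ) < d := by positivity
  unfold DCost
  simp only [mul_add, mul_sum]
  congr 1
  · exact sum_congr rfl fun t _ => by field_simp
  · refine sum_congr rfl fun t _ => ?_
    rw [mul_left_comm, mul_max_of_nonneg _ _ hd'.le]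
    push_cast
    ring_nf

/-- Proximity for an arbitrary scaling factor `d` in place of `2 ^ k`. -/
lemma exists_COptimal_near {T n d : ℕ} (hd : 0 < d) {β : ℝ} (hβ : 0 < β) {f : ℕ → ℕ → ℝ}
    (hconv : ∀ t ∈ Finset.Icc 1 T, ∀ a b : ℕ, a ≤ b → b + 1 ≤ d * n →
      f t (a + 1) - f t a ≤ f t (b + 1) - f t b)
    {x : ℕ → ℕ} (hx : DFeasible T n x)
    (hmin : ∀ y, DFeasible T n y →
      DCost T β f (fun t => d * x t) ≤ DCost T β f (fun t => d * y t)) :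
    ∃ xs : ℕ → ℝ, COptimal T (d * n) β f xs ∧
      ∀ t ∈ Finset.Icc 1 T, |((d * x t : ℕ) : ℝ) - xs t| < d := by
  set F : ℕ → ℕ → ℝ := fun t i => f t (d * i) / d with hF
  have hd' : (0 : ℝ) < d := by exact_mod_cast hd
  have hlow : ∀ j i, j ≤ d * i → i < n → ∀ t ∈ Finset.Icc 1 T,
      increment f j t ≤ increment F i t := by
    intro j i hji hi t ht
    have h1 : d * i + d ≤ d * n := by
      rw [← Nat.mul_succ]
      exact Nat.mul_le_mul_left d hi
    have := mul_increment_le_sub (hconv t ht) hji d h1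
    rw [increment, increment, hF, ← sub_div, le_div_iff₀ hd', mul_comm, mul_add_one]
    exact this
  have hhigh : ∀ j i, d * i + d ≤ j + 1 → j < d * n → ∀ t ∈ Finset.Icc 1 T,
      increment F i t ≤ increment f j t := by
    intro j i hji hj t ht
    have := sub_le_mul_increment (hconv t ht) hj d hji
    rw [increment, increment, hF, ← sub_div, div_le_iff₀ hd', mul_add_one, mul_comm _ (d : ℝ)]
    exact this
  have hFmono : ∀ i j, i ≤ j → j < n → ∀ t ∈ Finset.Icc 1 T, increment F i t ≤ increment F j t := by
    intro i j hij hj t ht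
    rcases eq_or_lt_of_le hij with rfl | h
    · exact le_rfl
    · have h1 : d * i + d ≤ d * j := by
        rw [← Nat.mul_succ]
        exact Nat.mul_le_mul_left d h
      have h2 : d * j < d * n := Nat.mul_lt_mul_of_pos_left hj hd
      exact (hhigh (d * j) i (by omega) h2 t ht).trans (hlow (d * j) j le_rfl hj t ht)
  have hxopt : ∀ i < n, LevelOptimal T β (increment F i) (fun t => lev i (x t)) := by
    refine fun i hi => levelOptimal_of_DCost_le hβ hFmono hx (fun y hy => ?_) hi
    have := hmin y hy
    rw [DCost_mul T β f hd, DCost_mul T β f hd] at this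
    exact le_of_mul_le_mul_left this hd'
  obtain ⟨y, hy, hyopt⟩ := exists_levelOptimal T (d * n) hβ (increment f)
    fun i j hij hj t ht => hconv t ht i j hij hj
  set z : ℕ → ℕ := fun t => min (max (y t) (d * x t - (d - 1))) (d * x t + (d - 1)) with hz
  have hzfeas : DFeasible T (d * n) z := by
    refine ⟨by simp [hz, hy.1, hx.1], fun t ht => ?_⟩
    have h1 := hy.2 t ht
    have h2 := Nat.mul_le_mul_left d (hx.2 t ht)
    simp only [hz]
    omega
  refine ⟨fun t => z t, COptimal_of_levelOptimal hzfeas.cast fun j hj => ?_, fun t ht => ?_⟩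
  · have hsup : LevelOptimal T β (increment f j)
        (fun t => lev j ((max (y t) (d * x t - (d - 1)) : ℕ) : ℝ)) := by
      have hlev : ∀ t, lev j ((d * x t - (d - 1) : ℕ) : ℝ) = lev ((j + (d - 1)) / d) (x t) := by
        intro t
        rw [lev_natCast, lev_natCast]
        refine if_congr ?_ rfl rfl
        rw [Nat.div_lt_iff_lt_mul hd, mul_comm (x t) d]
        omega
      have hj' : j ≤ d * ((j + (d - 1)) / d) := by
        have := Nat.lt_mul_div_succ (j + (d - 1)) hd
        rw [mul_add_one] at this
        omega
      rcases lt_or_ge ((j + (d - 1)) / d) n with h | h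
      · refine ((hyopt j hj).sup hβ (hlow j _ hj' h) (hxopt _ h)).congr fun t _ => ?_
        rw [← hlev, Nat.cast_max, (lev_mono j).map_max]
      · refine (hyopt j hj).congr fun t ht => ?_
        have hxt : x t ≤ n := by exact_mod_cast (hx.cast.bounds ht).2
        rw [Nat.cast_max, (lev_mono j).map_max, hlev t, lev_natCast ((j + (d - 1)) / d),
          if_neg (by omega), max_eq_left (lev_nonneg _ _)]
    have hmin' : ∀ t, lev j (z t : ℝ) =
        min (lev j ((d * x t + (d - 1) : ℕ) : ℝ))
          (lev j ((max (y t) (d * x t - (d - 1)) : ℕ) : ℝ)) := fun t => by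
      rw [← (lev_mono j).map_min, ← Nat.cast_min, min_comm]
    rcases lt_or_ge j (d - 1) with h | h
    · refine hsup.congr fun t _ => ?_
      rw [hmin', lev_natCast j (d * x t + (d - 1)), if_pos (by omega),
        min_eq_right (lev_le_one _ _)]
    · have hlev : ∀ t, lev j ((d * x t + (d - 1) : ℕ) : ℝ) = lev ((j - (d - 1)) / d) (x t) := by
        intro t
        rw [lev_natCast, lev_natCast]
        refine if_congr ?_ rfl rfl
        rw [Nat.div_lt_iff_lt_mul hd, mul_comm (x t) d]
        omega
      have hi := Nat.mul_div_le (j - (d - 1)) d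
      have hin : (j - (d - 1)) / d < n := by
        refine Nat.lt_of_mul_lt_mul_left (a := d) ?_
        omega
      refine ((hxopt _ hin).inf hβ (hhigh j _ (by omega) hj) hsup).congr fun t _ => ?_
      rw [hmin', hlev]
  · have h1 : d * x t < z t + d := by
      simp only [hz]
      omega
    have h2 : z t < d * x t + d := by
      simp only [hz]
      omega
    have h1' : ((d * x t : ℕ) : ℝ) < z t + d := by exact_mod_cast h1
    have h2' : (z t : ℝ) < (d * x t : ℕ) + d := by exact_mod_cast h2
    rw [abs_lt]
    constructor <;> linarith

/-- If `X̂ᵏ` is an optimal schedule for `P_k`, then there is an optimal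
schedule `X*` for the continuous extension `P̄` with `|x̂ᵏ_t − x*_t| < 2^k` for all
`t ∈ {1,…,T}`. -/
theorem stmt1 (T m K k : ℕ) (hm : m = 2 ^ K) (β : ℝ) (hβ : 0 < β)
    (f : ℕ → ℕ → ℝ)
    (hconv : ∀ t ∈ Finset.Icc 1 T, ∀ a b : ℕ, a ≤ b → b + 1 ≤ m →
      f t (a + 1) - f t a ≤ f t (b + 1) - f t b)
    (hnonneg : ∀ t ∈ Finset.Icc 1 T, ∀ j : ℕ, j ≤ m → 0 ≤ f t j)
    (xhat : ℕ → ℕ) (hxhat : DOptimalK T m β f k xhat) :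
    ∃ xs : ℕ → ℝ, COptimal T m β f xs ∧
      ∀ t ∈ Finset.Icc 1 T, |(xhat t : ℝ) - xs t| < (2 : ℝ) ^ k := by
  obtain ⟨hfeas, hdvd, hmin⟩ := hxhat
  rcases le_or_gt k K with hk | hk
  · obtain ⟨n, hn⟩ : 2 ^ k ∣ m := hm ▸ pow_dvd_pow 2 hk
    subst hn
    have hd : 0 < 2 ^ k := by positivity
    have hmul : ∀ t ≤ T, 2 ^ k * (xhat t / 2 ^ k) = xhat t := fun t ht => by
      rcases Nat.eq_zero_or_pos t with rfl | h
      · simp [hfeas.1]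
      · exact Nat.mul_div_cancel' (hdvd t (mem_Icc.2 ⟨h, ht⟩))
    have hcost : DCost T β f (fun t => 2 ^ k * (xhat t / 2 ^ k)) = DCost T β f xhat := by
      unfold DCost
      congr 1
      · exact sum_congr rfl fun t ht => by
          simp only [hmul t (mem_Icc.1 ht).2]
      · congr 1
        refine sum_congr rfl fun t ht => ?_
        have := (mem_Icc.1 ht).2
        simp only [hmul t this, hmul (t - 1) (by omega)]
    obtain ⟨xs, hxs, hnear⟩ := exists_COptimal_near hd hβ hconv
      (x := fun t => xhat t / 2 ^ k)
      ⟨by simp [hfeas.1], fun t ht => Nat.div_le_of_le_mul (hfeas.2 t ht)⟩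
      (fun y hy => hcost ▸ hmin _
        ⟨by simp [hy.1], fun t ht => Nat.mul_le_mul_left _ (hy.2 t ht)⟩
        fun t _ => dvd_mul_right _ _)
    refine ⟨xs, hxs, fun t ht => ?_⟩
    have := hnear t ht
    rw [hmul t (mem_Icc.1 ht).2] at this
    exact_mod_cast this
  · obtain ⟨y, hy, hyopt⟩ := exists_levelOptimal T m hβ (increment f)
      fun i j hij hj t ht => hconv t ht i j hij hj
    refine ⟨fun t => y t, COptimal_of_levelOptimal hy.cast hyopt, fun t ht => ?_⟩
    have hmk : m < 2 ^ k := hm ▸ Nat.pow_lt_pow_right one_lt_two hk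
    have h0 : xhat t = 0 :=
      Nat.eq_zero_of_dvd_of_lt (hdvd t ht) ((hfeas.2 t ht).trans_lt hmk)
    rw [h0, Nat.cast_zero, zero_sub, abs_neg, Nat.abs_cast]
    exact_mod_cast (hy.2 t ht).trans_lt hmk
end
end

section
/- Let X* = (x*_1,…,x*_T) be an optimal schedule for the continuous extension P̄ of the discrete data-center optimization problem. Then the rounded schedules ⌊X*⌋ = (⌊x*_1⌋,…,⌊x*_T⌋) and ⌈X*⌉ = (⌈x*_1⌉,…,⌈x*_T⌉) are also optimal for P̄, i.e. C̄(⌊X*⌋) = C̄(⌈X*⌉) = C̄(X*) = min over all fractional schedules of C̄. -/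
open Finset

noncomputable section

lemma interp_eq_of_mem_Icc (f : ℕ → ℝ) (n : ℕ) {x : ℝ} (h₁ : (n : ℝ) ≤ x) (h₂ : x ≤ n + 1) :
    interp f x = (1 - (x - n)) * f n + (x - n) * f (n + 1) := by
  rcases h₂.lt_or_eq with h | rfl
  · have hn : ⌊x⌋₊ = n := (Nat.floor_eq_iff (n.cast_nonneg.trans h₁)).2 ⟨h₁, h⟩
    simp [interp, hn]
  · have hn : ⌊(n : ℝ) + 1⌋₊ = n + 1 := by exact_mod_cast Nat.floor_natCast (R := ℝ) (n + 1)
    simp [interp, hn]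

lemma eventually_lt_add_mul {a c : ℝ} (d : ℝ) (h : c < a) :
    ∀ᶠ ε : ℝ in nhdsWithin 0 (Set.Ioi 0), c < a + ε * d := by
  have hc : Filter.Tendsto (fun ε : ℝ => a + ε * d) (nhds 0) (nhds a) := by
    have : Continuous fun ε : ℝ => a + ε * d := by fun_prop
    simpa using this.tendsto 0
  exact (hc.mono_left nhdsWithin_le_nhds).eventually_const_lt h

lemma eventually_add_mul_lt {a c : ℝ} (d : ℝ) (h : a < c) :
    ∀ᶠ ε : ℝ in nhdsWithin 0 (Set.Ioi 0), a + ε * d < c := by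
  filter_upwards [eventually_lt_add_mul (-d) (neg_lt_neg h)] with ε hε
  linarith

/-- `r` rounds every nonnegative real within its unit cell and fixes the integers. -/
def IsCellRounding (r : ℝ → ℝ) : Prop :=
  ∀ x, 0 ≤ x → r x = x ∨ ∃ n : ℕ, (n : ℝ) < x ∧ x < n + 1 ∧ (n : ℝ) ≤ r x ∧ r x ≤ n + 1

lemma isCellRounding_floor : IsCellRounding fun x => (⌊x⌋₊ : ℝ) := by
  intro x hx
  rcases (Nat.floor_le hx).eq_or_lt with h | h
  · exact Or.inl h
  · exact Or.inr ⟨⌊x⌋₊, h, Nat.lt_floor_add_one x, le_rfl, by simp⟩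

lemma isCellRounding_ceil : IsCellRounding fun x => (⌈x⌉₊ : ℝ) := by
  intro x hx
  rcases (Nat.floor_le hx).eq_or_lt with h | h
  · left
    dsimp only
    rw [← h, Nat.ceil_natCast]
  · refine Or.inr ⟨⌊x⌋₊, h, Nat.lt_floor_add_one x, h.le.trans (Nat.le_ceil x), ?_⟩
    dsimp only
    exact_mod_cast Nat.ceil_le_floor_add_one x

lemma IsCellRounding.mem_Icc {r : ℝ → ℝ} (hr : IsCellRounding r) {m : ℕ} {x : ℝ}
    (hx : x ∈ Set.Icc (0 : ℝ) m) : r x ∈ Set.Icc (0 : ℝ) m := by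
  rcases hr x hx.1 with h | ⟨n, h₁, -, h₃, h₄⟩
  · rwa [h]
  · have hn : n + 1 ≤ m := by exact_mod_cast h₁.trans_le hx.2
    have hn' : (n : ℝ) + 1 ≤ m := by exact_mod_cast hn
    exact ⟨n.cast_nonneg.trans h₃, h₄.trans hn'⟩

lemma IsCellRounding.eventually_mem_Icc {r : ℝ → ℝ} (hr : IsCellRounding r) {m : ℕ} {x : ℝ}
    (hx : x ∈ Set.Icc (0 : ℝ) m) :
    ∀ᶠ ε : ℝ in nhdsWithin 0 (Set.Ioi 0), x + ε * (x - r x) ∈ Set.Icc (0 : ℝ) m := by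
  rcases hr x hx.1 with h | ⟨n, h₁, h₂, -, -⟩
  · simpa [h] using hx
  · have hn : n + 1 ≤ m := by exact_mod_cast h₁.trans_le hx.2
    have hn' : (n : ℝ) + 1 ≤ m := by exact_mod_cast hn
    filter_upwards [eventually_lt_add_mul (x - r x) h₁, eventually_add_mul_lt (x - r x) h₂]
      with ε h₅ h₆
    exact ⟨n.cast_nonneg.trans h₅.le, h₆.le.trans hn'⟩

lemma IsCellRounding.eventually_interp_eq {r : ℝ → ℝ} (hr : IsCellRounding r) (f : ℕ → ℝ)
    {x : ℝ} (hx : 0 ≤ x) :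
    ∀ᶠ ε : ℝ in nhdsWithin 0 (Set.Ioi 0),
      interp f (x + ε * (x - r x)) = interp f x + ε * (interp f x - interp f (r x)) := by
  rcases hr x hx with h | ⟨n, h₁, h₂, h₃, h₄⟩
  · simp [h]
  · filter_upwards [eventually_lt_add_mul (x - r x) h₁, eventually_add_mul_lt (x - r x) h₂]
      with ε h₅ h₆
    rw [interp_eq_of_mem_Icc f n h₅.le h₆.le, interp_eq_of_mem_Icc f n h₁.le h₂.le,
      interp_eq_of_mem_Icc f n h₃ h₄]
    ring

lemma Monotone.eventually_max_sub_eq {r : ℝ → ℝ} (hr : Monotone r) (a b : ℝ) :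
    ∀ᶠ ε : ℝ in nhdsWithin 0 (Set.Ioi 0),
      max (a + ε * (a - r a) - (b + ε * (b - r b))) 0 =
        max (a - b) 0 + ε * (max (a - b) 0 - max (r a - r b) 0) := by
  rcases lt_trichotomy a b with h | rfl | h
  · filter_upwards [eventually_add_mul_lt (a - b - (r a - r b)) (sub_neg.2 h)] with ε hε
    rw [max_eq_right (by linarith), max_eq_right (sub_neg.2 h).le,
      max_eq_right (sub_nonpos.2 (hr h.le))]
    ring
  · simp
  · filter_upwards [eventually_lt_add_mul (a - b - (r a - r b)) (sub_pos.2 h)] with ε hε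
    rw [max_eq_left (by linarith), max_eq_left (sub_pos.2 h).le,
      max_eq_left (sub_nonneg.2 (hr h.le))]
    ring

/-- Monotone rounding within unit cells preserves optimality: the cost is affine along the segment
from the rounded schedule to the optimal one, and slightly beyond it. -/
theorem COptimal.comp_cellRounding {T m : ℕ} {β : ℝ} {f : ℕ → ℕ → ℝ} {x : ℕ → ℝ}
    (hx : COptimal T m β f x) {r : ℝ → ℝ} (hr : IsCellRounding r) (hmono : Monotone r)
    (hr0 : r 0 = 0) : COptimal T m β f fun t => r (x t) := by
  obtain ⟨⟨hx0, hxm⟩, hopt⟩ := hx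
  refine ⟨⟨by simp [hx0, hr0], fun t ht => hr.mem_Icc (hxm t ht)⟩,
    fun y hy => le_trans ?_ (hopt y hy)⟩
  have hmem := (Filter.eventually_all_finset (Icc 1 T)).2 fun t ht =>
    hr.eventually_mem_Icc (hxm t ht)
  have hinterp := (Filter.eventually_all_finset (Icc 1 T)).2 fun t ht =>
    hr.eventually_interp_eq (f t) (hxm t ht).1
  have hmax := (Filter.eventually_all_finset (Icc 1 T)).2 fun t _ =>
    hmono.eventually_max_sub_eq (x t) (x (t - 1))
  obtain ⟨ε, hε, h₁, h₂, h₃⟩ :=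
    ((eventually_mem_nhdsWithin (a := (0 : ℝ)) (s := Set.Ioi 0)).and
      (hmem.and (hinterp.and hmax))).exists
  have hle := hopt (fun t => x t + ε * (x t - r (x t))) ⟨by simp [hx0, hr0], h₁⟩
  have heq : CCost T β f (fun t => x t + ε * (x t - r (x t))) =
      CCost T β f x + ε * (CCost T β f x - CCost T β f fun t => r (x t)) := by
    unfold CCost
    rw [Finset.sum_congr rfl h₂, Finset.sum_congr rfl h₃]
    simp only [Finset.sum_add_distrib, ← Finset.mul_sum, Finset.sum_sub_distrib]
    ring
  rw [heq] at hle
  exact sub_nonneg.1 (nonneg_of_mul_nonneg_right (by linarith) hε)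

/-- If `X*` is an optimal schedule for the continuous extension `P̄`,
then the rounded schedules `⌊X*⌋` and `⌈X*⌉` are also optimal for `P̄`. -/
theorem stmt2 (T m : ℕ) (β : ℝ) (hβ : 0 < β)
    (f : ℕ → ℕ → ℝ)
    (hconv : ∀ t ∈ Finset.Icc 1 T, ∀ a b : ℕ, a ≤ b → b + 1 ≤ m →
      f t (a + 1) - f t a ≤ f t (b + 1) - f t b)
    (hnonneg : ∀ t ∈ Finset.Icc 1 T, ∀ j : ℕ, j ≤ m → 0 ≤ f t j)
    (xs : ℕ → ℝ) (hxs : COptimal T m β f xs) :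
    COptimal T m β f (fun t => (⌊xs t⌋₊ : ℝ)) ∧
      COptimal T m β f (fun t => (⌈xs t⌉₊ : ℝ)) := by
  exact ⟨hxs.comp_cellRounding isCellRounding_floor (Nat.mono_cast.comp Nat.floor_mono) (by simp),
    hxs.comp_cellRounding isCellRounding_ceil (Nat.mono_cast.comp Nat.ceil_mono) (by simp)⟩
end
end

section
/- Let k > l ≥ 0 and let X̂^k = (x̂^k_1,…,x̂^k_T) be an arbitrary optimal schedule for P_k (states restricted to multiples of 2^k). Then there exists an optimal schedule X̂^l = (x̂^l_1,…,x̂^l_T) for P_l (states restricted to multiples of 2^l) such that |x̂^k_t − x̂^l_t| ≤ 2^k for all t ∈ {1,…,T}. -/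
open Finset

noncomputable section

/-- Slopes of a discretely convex function over consecutive intervals are ordered. -/
theorem sub_mul_sub_le_of_le_of_le {m : ℕ} {φ : ℕ → ℝ}
    (hφ : ∀ a b : ℕ, a ≤ b → b + 1 ≤ m → φ (a + 1) - φ a ≤ φ (b + 1) - φ b)
    {a b c d : ℕ} (hab : a ≤ b) (hbc : b ≤ c) (hcd : c ≤ d) (hd : d ≤ m) :
    ((d : ℝ) - c) * (φ b - φ a) ≤ ((b : ℝ) - a) * (φ d - φ c) := by
  rcases hcd.eq_or_lt with rfl | hlt
  · simp
  set s := φ (c + 1) - φ c with hs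
  have hleft : ∀ n, a + n ≤ c → φ (a + n) - φ a ≤ n * s := by
    intro n
    induction n with
    | zero => simp
    | succ n ih =>
      intro h
      have h1 := ih (by omega)
      have h2 := hφ (a + n) c (by omega) (by omega)
      rw [← add_assoc]
      push_cast
      linarith
  have hright : ∀ n, c + n ≤ m → n * s ≤ φ (c + n) - φ c := by
    intro n
    induction n with
    | zero => simp
    | succ n ih =>
      intro h
      have h1 := ih (by omega)
      have h2 := hφ c (c + n) (by omega) (by omega)
      rw [← add_assoc]
      push_cast
      linarith
  obtain ⟨p, rfl⟩ := Nat.exists_eq_add_of_le hab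
  obtain ⟨r, rfl⟩ := Nat.exists_eq_add_of_le hcd
  have h1 := mul_le_mul_of_nonneg_left (hleft p hbc) (Nat.cast_nonneg (α := ℝ) r)
  have h2 := mul_le_mul_of_nonneg_left (hright r hd) (Nat.cast_nonneg (α := ℝ) p)
  push_cast
  linarith

/-- The slope of a discretely convex function over an interval increases when both endpoints
move to the right. -/
theorem slope_mono_of_endpoints_le {m : ℕ} {φ : ℕ → ℝ}
    (hφ : ∀ a b : ℕ, a ≤ b → b + 1 ≤ m → φ (a + 1) - φ a ≤ φ (b + 1) - φ b)
    {a b a' b' : ℕ} (hab : a ≤ b) (hab' : a' ≤ b') (ha : a ≤ a') (hb : b ≤ b') (hm : b' ≤ m) :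
    ((b' : ℝ) - a') * (φ b - φ a) ≤ ((b : ℝ) - a) * (φ b' - φ a') := by
  rcases le_total b a' with h | h
  · exact sub_mul_sub_le_of_le_of_le hφ hab h hab' hm
  · have h1 := sub_mul_sub_le_of_le_of_le hφ ha le_rfl h (hb.trans hm)
    have h2 := sub_mul_sub_le_of_le_of_le hφ ha h hb hm
    have h3 := sub_mul_sub_le_of_le_of_le hφ h le_rfl hb hm
    linarith

/-- Hermite's identity for integer division. -/
theorem sum_range_add_ediv (D : ℕ) (hD : 0 < D) (w : ℤ) :
    ∑ θ ∈ Finset.range D, (w + θ) / (D : ℤ) = w := by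
  have hD' : (D : ℤ) ≠ 0 := by exact_mod_cast hD.ne'
  have step : ∀ v : ℤ, ∑ θ ∈ Finset.range D, (v + 1 + θ) / (D : ℤ)
      = ∑ θ ∈ Finset.range D, (v + θ) / (D : ℤ) + 1 := by
    intro v
    have h1 := Finset.sum_range_succ (fun θ : ℕ => (v + θ) / (D : ℤ)) D
    have h2 := Finset.sum_range_succ' (fun θ : ℕ => (v + θ) / (D : ℤ)) D
    rw [h1, Int.add_ediv_of_dvd_right (dvd_refl _), Int.ediv_self hD'] at h2
    have h3 : ∀ θ : ℕ, v + 1 + (θ : ℤ) = v + ((θ + 1 : ℕ) : ℤ) := by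
      intro θ; push_cast; ring
    simp only [h3]
    simp only [Nat.cast_zero, add_zero] at h2
    linarith
  induction w using Int.induction_on with
  | zero =>
    apply Finset.sum_eq_zero
    intro θ hθ
    rw [Finset.mem_range] at hθ
    exact Int.ediv_eq_zero_of_lt (by omega) (by omega)
  | succ i ih => rw [step, ih]
  | pred i ih =>
    have h := step (-(i : ℤ) - 1)
    rw [sub_add_cancel, ih] at h
    linarith

/-- The integer `w` rounded to a multiple of `D` after a shift by `θ`. -/
def shiftRound (D : ℕ) (w : ℤ) (θ : ℕ) : ℤ := D * ((w + θ) / D)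

theorem shiftRound_le {D : ℕ} (hD : 0 < D) (w : ℤ) (θ : ℕ) : shiftRound D w θ ≤ w + θ :=
  Int.mul_ediv_self_le (by omega)

theorem lt_shiftRound_add {D : ℕ} (hD : 0 < D) (w : ℤ) (θ : ℕ) :
    w + θ < shiftRound D w θ + D :=
  Int.lt_mul_ediv_self_add (by omega)

theorem dvd_shiftRound (D : ℕ) (w : ℤ) (θ : ℕ) : (D : ℤ) ∣ shiftRound D w θ :=
  dvd_mul_right _ _

theorem sum_shiftRound (D : ℕ) (hD : 0 < D) (w : ℤ) :
    ∑ θ ∈ Finset.range D, shiftRound D w θ = D * w := by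
  simp only [shiftRound, ← Finset.mul_sum, sum_range_add_ediv D hD]

theorem shiftRound_zero {D θ : ℕ} (hθ : θ < D) : shiftRound D 0 θ = 0 := by
  simp [shiftRound, Int.ediv_eq_zero_of_lt (show (0 : ℤ) ≤ θ by omega)
    (show (θ : ℤ) < D by omega)]

theorem shiftRound_nonneg {D : ℕ} {w : ℤ} (hw : 0 ≤ w) (θ : ℕ) : 0 ≤ shiftRound D w θ :=
  mul_nonneg (by omega) (Int.ediv_nonneg (by omega) (by omega))

theorem shiftRound_nonpos {D θ : ℕ} {w : ℤ} (hw : w ≤ 0) (hθ : θ < D) :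
    shiftRound D w θ ≤ 0 := by
  have h1 := shiftRound_le (show 0 < D by omega) w θ
  obtain ⟨n, hn⟩ := dvd_shiftRound D w θ
  rw [hn] at h1 ⊢
  have : n < 1 := by
    by_contra! h
    nlinarith
  nlinarith

/-- On average over the shifts, rounding does not increase the positive part of an increment. -/
theorem sum_max_shiftRound_le {D : ℕ} (hD : 0 < D) {p : ℤ} (hp : (D : ℤ) ∣ p) (a b : ℤ) :
    ∑ θ ∈ Finset.range D, max (p + shiftRound D a θ - shiftRound D b θ) 0
      ≤ D * max (p + a - b) 0 := by
  have hdvd : ∀ θ : ℕ, (D : ℤ) ∣ p + shiftRound D a θ - shiftRound D b θ := fun θ =>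
    dvd_sub (dvd_add hp (dvd_shiftRound D a θ)) (dvd_shiftRound D b θ)
  have bounds : ∀ θ : ℕ, p + a - b - D < p + shiftRound D a θ - shiftRound D b θ ∧
      p + shiftRound D a θ - shiftRound D b θ < p + a - b + D := by
    intro θ
    have h1 := shiftRound_le hD a θ
    have h2 := lt_shiftRound_add hD a θ
    have h3 := shiftRound_le hD b θ
    have h4 := lt_shiftRound_add hD b θ
    constructor <;> linarith
  rcases le_total 0 (p + a - b) with h | h
  · have key : ∀ θ ∈ Finset.range D, max (p + shiftRound D a θ - shiftRound D b θ) 0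
        = p + shiftRound D a θ - shiftRound D b θ := by
      intro θ _
      apply max_eq_left
      obtain ⟨n, hn⟩ := hdvd θ
      have := (bounds θ).1
      rw [hn] at this ⊢
      have : -1 < n := by
        by_contra! h'
        nlinarith
      exact mul_nonneg (by omega) (by omega)
    rw [Finset.sum_congr rfl key, max_eq_left h, Finset.sum_sub_distrib, Finset.sum_add_distrib,
      sum_shiftRound D hD, sum_shiftRound D hD]
    simp
    linarith
  · rw [max_eq_right h, mul_zero]
    apply le_of_eq
    apply Finset.sum_eq_zero
    intro θ _
    apply max_eq_right
    obtain ⟨n, hn⟩ := hdvd θ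
    have := (bounds θ).2
    rw [hn] at this ⊢
    have : n < 1 := by
      by_contra! h'
      nlinarith
    nlinarith

/-- The number `y` clamped to the interval `[x - D, x + D]`. -/
def clampAround (D x y : ℕ) : ℕ := min (max y (x - D)) (x + D)

/-- The state `x` perturbed by the rounded excess of `y` over `[x - D, x + D]`. -/
def roundedMove (D x y θ : ℕ) : ℕ :=
  ((x : ℤ) + shiftRound D ((y : ℤ) - clampAround D x y) θ).toNat

theorem coe_roundedMove {D : ℕ} (hD : 0 < D) (x y θ : ℕ) (hθ : θ < D) :
    (roundedMove D x y θ : ℤ) = x + shiftRound D ((y : ℤ) - clampAround D x y) θ := by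
  apply Int.toNat_of_nonneg
  rcases le_total 0 ((y : ℤ) - clampAround D x y) with h | h
  · have := shiftRound_nonneg (D := D) h θ
    omega
  · rcases h.eq_or_lt with h | h
    · rw [h, shiftRound_zero hθ]; omega
    · have := lt_shiftRound_add hD ((y : ℤ) - clampAround D x y) θ
      simp only [clampAround] at *
      omega

theorem roundedMove_le {D m x y θ : ℕ} (hθ : θ < D) (hx : x ≤ m) (hy : y ≤ m) :
    roundedMove D x y θ ≤ m := by
  have hD : 0 < D := by omega
  zify
  rw [coe_roundedMove hD x y θ hθ]
  rcases le_or_gt ((y : ℤ) - clampAround D x y) 0 with h | h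
  · have := shiftRound_nonpos h hθ
    omega
  · have := shiftRound_le hD ((y : ℤ) - clampAround D x y) θ
    simp only [clampAround] at *
    omega

theorem dvd_roundedMove {D x y θ : ℕ} (hθ : θ < D) (hx : D ∣ x) :
    D ∣ roundedMove D x y θ := by
  zify
  rw [coe_roundedMove (by omega) x y θ hθ]
  exact dvd_add (by exact_mod_cast hx) (dvd_shiftRound _ _ _)

theorem sum_apply_roundedMove_le {m D : ℕ} (hD : 0 < D) {φ : ℕ → ℝ}
    (hφ : ∀ a b : ℕ, a ≤ b → b + 1 ≤ m → φ (a + 1) - φ a ≤ φ (b + 1) - φ b)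
    {x y : ℕ} (hx : x ≤ m) (hy : y ≤ m) :
    ∑ θ ∈ Finset.range D, (φ (roundedMove D x y θ) - φ x)
      ≤ D * (φ y - φ (clampAround D x y)) := by
  set w : ℤ := (y : ℤ) - clampAround D x y with hw
  have hsum : ∑ θ ∈ Finset.range D, ((roundedMove D x y θ : ℝ) - x) = D * (w : ℝ) := by
    have h := sum_shiftRound D hD w
    have h' : ∑ θ ∈ Finset.range D, ((roundedMove D x y θ : ℤ) - x) = D * w := by
      rw [← h]
      refine Finset.sum_congr rfl fun θ hθ => ?_
      rw [coe_roundedMove hD x y θ (Finset.mem_range.1 hθ)]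
      ring
    exact_mod_cast h'
  have hwR : (w : ℝ) = (y : ℝ) - clampAround D x y := by rw [hw]; push_cast; ring
  rcases lt_trichotomy w 0 with h | h | h
  · have key : ∀ θ ∈ Finset.range D, ((roundedMove D x y θ : ℝ) - x) *
        (φ y - φ (clampAround D x y)) ≤ (w : ℝ) * (φ (roundedMove D x y θ) - φ x) := by
      intro θ hθ
      have hθ := Finset.mem_range.1 hθ
      have h0 : (roundedMove D x y θ : ℤ) = x + shiftRound D w θ := coe_roundedMove hD x y θ hθ
      have hc : clampAround D x y = min (max y (x - D)) (x + D) := rfl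
      have h1 := shiftRound_nonpos h.le hθ
      have h2 := lt_shiftRound_add hD w θ
      have h3 := slope_mono_of_endpoints_le hφ (a := y) (b := clampAround D x y)
        (a' := roundedMove D x y θ) (b' := x) (by omega) (by omega)
        (by omega) (by omega) hx
      rw [hwR]
      linarith
    have hs := Finset.sum_le_sum key
    rw [← Finset.sum_mul, ← Finset.mul_sum, hsum] at hs
    have hneg : (w : ℝ) < 0 := by exact_mod_cast h
    by_contra! hc
    nlinarith [mul_lt_mul_of_neg_left hc hneg]
  · have hyc : y = clampAround D x y := by omega
    rw [← hyc, sub_self, mul_zero]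
    apply le_of_eq
    apply Finset.sum_eq_zero
    intro θ hθ
    have h0 := coe_roundedMove hD x y θ (Finset.mem_range.1 hθ)
    rw [← hw, h, shiftRound_zero (Finset.mem_range.1 hθ)] at h0
    rw [show roundedMove D x y θ = x by omega, sub_self]
  · have key : ∀ θ ∈ Finset.range D, (w : ℝ) * (φ (roundedMove D x y θ) - φ x)
        ≤ ((roundedMove D x y θ : ℝ) - x) * (φ y - φ (clampAround D x y)) := by
      intro θ hθ
      have hθ := Finset.mem_range.1 hθ
      have h0 : (roundedMove D x y θ : ℤ) = x + shiftRound D w θ := coe_roundedMove hD x y θ hθ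
      have hc : clampAround D x y = min (max y (x - D)) (x + D) := rfl
      have h1 := shiftRound_nonneg (D := D) h.le θ
      have h2 := shiftRound_le hD w θ
      have h3 := slope_mono_of_endpoints_le hφ (a := x) (b := roundedMove D x y θ)
        (a' := clampAround D x y) (b' := y) (by omega) (by omega)
        (by omega) (by omega) hy
      rw [hwR]
      linarith
    have hs := Finset.sum_le_sum key
    rw [← Finset.sum_mul, ← Finset.mul_sum, hsum] at hs
    have hpos : (0 : ℝ) < w := by exact_mod_cast h
    by_contra! hc
    nlinarith [mul_lt_mul_of_pos_left hc hpos]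

theorem sum_increment_roundedMove_le {D : ℕ} (hD : 0 < D) {x₀ x₁ : ℕ} (y₀ y₁ : ℕ)
    (h₀ : D ∣ x₀) (h₁ : D ∣ x₁) :
    ∑ θ ∈ Finset.range D,
        (max ((roundedMove D x₁ y₁ θ : ℝ) - roundedMove D x₀ y₀ θ) 0 - max ((x₁ : ℝ) - x₀) 0)
      ≤ D * (max ((y₁ : ℝ) - y₀) 0
          - max ((clampAround D x₁ y₁ : ℝ) - clampAround D x₀ y₀) 0) := by
  have hint : ∑ θ ∈ Finset.range D,
        (max ((roundedMove D x₁ y₁ θ : ℤ) - roundedMove D x₀ y₀ θ) 0 - max ((x₁ : ℤ) - x₀) 0)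
      ≤ D * (max ((y₁ : ℤ) - y₀) 0
          - max ((clampAround D x₁ y₁ : ℤ) - clampAround D x₀ y₀) 0) := by
    have hp : (D : ℤ) ∣ (x₁ : ℤ) - x₀ :=
      dvd_sub (by exact_mod_cast h₁) (by exact_mod_cast h₀)
    have h := sum_max_shiftRound_le hD hp ((y₁ : ℤ) - clampAround D x₁ y₁)
      ((y₀ : ℤ) - clampAround D x₀ y₀)
    have hcongr : ∑ θ ∈ Finset.range D,
        max ((roundedMove D x₁ y₁ θ : ℤ) - roundedMove D x₀ y₀ θ) 0 =
        ∑ θ ∈ Finset.range D, max ((x₁ : ℤ) - x₀ + shiftRound D ((y₁ : ℤ) - clampAround D x₁ y₁) θ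
          - shiftRound D ((y₀ : ℤ) - clampAround D x₀ y₀) θ) 0 := by
      refine Finset.sum_congr rfl fun θ hθ => ?_
      have hθ := Finset.mem_range.1 hθ
      rw [coe_roundedMove hD _ _ _ hθ, coe_roundedMove hD _ _ _ hθ]
      congr 1
      ring
    have hconvex : max ((x₁ : ℤ) - x₀ + ((y₁ : ℤ) - clampAround D x₁ y₁)
        - ((y₀ : ℤ) - clampAround D x₀ y₀)) 0 - max ((x₁ : ℤ) - x₀) 0
        ≤ max ((y₁ : ℤ) - y₀) 0 - max ((clampAround D x₁ y₁ : ℤ) - clampAround D x₀ y₀) 0 := by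
      simp only [clampAround]
      omega
    rw [Finset.sum_sub_distrib, hcongr, Finset.sum_const, Finset.card_range, nsmul_eq_mul]
    have hD' : (0 : ℤ) ≤ D := by omega
    nlinarith [mul_le_mul_of_nonneg_left hconvex hD']
  exact_mod_cast hint

theorem DCost_congr {T : ℕ} {β : ℝ} {f : ℕ → ℕ → ℝ} {x y : ℕ → ℕ} (h : ∀ t ≤ T, x t = y t) :
    DCost T β f x = DCost T β f y := by
  unfold DCost
  congr 1
  · refine Finset.sum_congr rfl fun t ht => ?_
    rw [h t (Finset.mem_Icc.1 ht).2]
  · congr 1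
    refine Finset.sum_congr rfl fun t ht => ?_
    have := (Finset.mem_Icc.1 ht).2
    rw [h t this, h (t - 1) (by omega)]

theorem exists_DOptimalK (T m : ℕ) (β : ℝ) (f : ℕ → ℕ → ℝ) (l : ℕ) :
    ∃ y, DOptimalK T m β f l y := by
  let ext : (Fin (T + 1) → Fin (m + 1)) → ℕ → ℕ := fun g t =>
    if h : t < T + 1 then (g ⟨t, h⟩ : ℕ) else 0
  let S : Set (Fin (T + 1) → Fin (m + 1)) :=
    {g | DFeasible T m (ext g) ∧ ∀ t ∈ Finset.Icc 1 T, 2 ^ l ∣ ext g t}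
  have hne : S.Nonempty := by
    refine ⟨fun _ => 0, ⟨?_, ?_⟩, ?_⟩ <;> simp [ext]
  obtain ⟨g, hg, hmin⟩ := Set.exists_min_image S (fun g => DCost T β f (ext g)) S.toFinite hne
  refine ⟨ext g, hg.1, hg.2, fun y hy hdvd => ?_⟩
  have hle : ∀ t ≤ T, y t < m + 1 := by
    intro t ht
    rcases Nat.eq_zero_or_pos t with rfl | h
    · rw [hy.1]; omega
    · have := hy.2 t (Finset.mem_Icc.2 ⟨h, ht⟩)
      omega
  let g' : Fin (T + 1) → Fin (m + 1) := fun t => ⟨y t, hle t (by omega)⟩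
  have hext : ∀ t ≤ T, ext g' t = y t := fun t ht => by
    simp [ext, g', ht.not_gt]
  have hg' : g' ∈ S := by
    refine ⟨⟨?_, fun t ht => ?_⟩, fun t ht => ?_⟩
    · rw [hext 0 (by omega), hy.1]
    · rw [hext t (Finset.mem_Icc.1 ht).2]; exact hy.2 t ht
    · rw [hext t (Finset.mem_Icc.1 ht).2]; exact hdvd t ht
  exact (hmin g' hg').trans_eq (DCost_congr hext)

/-- Averaging over all shifts, moving `x` by the rounded excess of `y` costs at most what
is saved by clamping `y` around `x`. -/
theorem sum_DCost_roundedMove_le {T m D : ℕ} (hD : 0 < D) {β : ℝ} (hβ : 0 ≤ β) {f : ℕ → ℕ → ℝ}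
    (hconv : ∀ t ∈ Finset.Icc 1 T, ∀ a b : ℕ, a ≤ b → b + 1 ≤ m →
      f t (a + 1) - f t a ≤ f t (b + 1) - f t b)
    {x y : ℕ → ℕ} (hx : DFeasible T m x) (hxD : ∀ t ∈ Finset.Icc 1 T, D ∣ x t)
    (hy : DFeasible T m y) :
    ∑ θ ∈ Finset.range D, (DCost T β f (fun t => roundedMove D (x t) (y t) θ) - DCost T β f x)
      ≤ D * (DCost T β f y - DCost T β f (fun t => clampAround D (x t) (y t))) := by
  have hxD' : ∀ t ≤ T, D ∣ x t := by
    intro t ht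
    rcases Nat.eq_zero_or_pos t with rfl | h
    · rw [hx.1]; exact dvd_zero D
    · exact hxD t (Finset.mem_Icc.2 ⟨h, ht⟩)
  have h1 := Finset.sum_le_sum fun t ht =>
    sum_apply_roundedMove_le hD (hconv t ht) (hx.2 t ht) (hy.2 t ht)
  have h2 := Finset.sum_le_sum fun t (ht : t ∈ Finset.Icc 1 T) =>
    sum_increment_roundedMove_le hD (y (t - 1)) (y t)
      (hxD' (t - 1) (by have := Finset.mem_Icc.1 ht; omega)) (hxD t ht)
  rw [Finset.sum_comm, ← Finset.mul_sum] at h1 h2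
  have h3 := add_le_add h1 (mul_le_mul_of_nonneg_left h2 hβ)
  rw [Finset.mul_sum, ← Finset.sum_add_distrib] at h3
  simp only [Finset.sum_sub_distrib] at h3
  simp only [DCost]
  refine le_trans (le_of_eq ?_) (h3.trans (le_of_eq ?_))
  · refine Finset.sum_congr rfl fun θ _ => ?_
    ring
  · ring

/-- For `k > l ≥ 0`, if `X̂ᵏ` is an optimal schedule for `P_k`, then
there is an optimal schedule `X̂ˡ` for `P_l` with `|x̂ᵏ_t − x̂ˡ_t| ≤ 2^k` for all
`t ∈ {1,…,T}`. -/
theorem stmt3 (T m K k l : ℕ) (hm : m = 2 ^ K) (hlk : l < k) (β : ℝ) (hβ : 0 < β)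
    (f : ℕ → ℕ → ℝ)
    (hconv : ∀ t ∈ Finset.Icc 1 T, ∀ a b : ℕ, a ≤ b → b + 1 ≤ m →
      f t (a + 1) - f t a ≤ f t (b + 1) - f t b)
    (hnonneg : ∀ t ∈ Finset.Icc 1 T, ∀ j : ℕ, j ≤ m → 0 ≤ f t j)
    (xk : ℕ → ℕ) (hxk : DOptimalK T m β f k xk) :
    ∃ xl : ℕ → ℕ, DOptimalK T m β f l xl ∧
      ∀ t ∈ Finset.Icc 1 T, |(xk t : ℝ) - (xl t : ℝ)| ≤ (2 : ℝ) ^ k := by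
  have hD : 0 < 2 ^ k := by positivity
  obtain ⟨hx, hxD, hxmin⟩ := hxk
  obtain ⟨y, hy, hyd, hymin⟩ := exists_DOptimalK T m β f l
  have hsum := sum_DCost_roundedMove_le hD hβ.le hconv hx hxD hy
  have hnonneg_sum : 0 ≤ ∑ θ ∈ Finset.range (2 ^ k),
      (DCost T β f (fun t => roundedMove (2 ^ k) (xk t) (y t) θ) - DCost T β f xk) := by
    refine Finset.sum_nonneg fun θ hθ => sub_nonneg.2 (hxmin _ ⟨?_, fun t ht => ?_⟩ fun t ht => ?_)
    · have := coe_roundedMove hD (xk 0) (y 0) θ (Finset.mem_range.1 hθ)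
      simp only [hx.1, hy.1] at this ⊢
      simpa [clampAround, shiftRound_zero (Finset.mem_range.1 hθ)] using this
    · exact roundedMove_le (Finset.mem_range.1 hθ) (hx.2 t ht) (hy.2 t ht)
    · exact dvd_roundedMove (Finset.mem_range.1 hθ) (hxD t ht)
  have hcost : DCost T β f (fun t => clampAround (2 ^ k) (xk t) (y t)) ≤ DCost T β f y :=
    sub_nonneg.1 (nonneg_of_mul_nonneg_right (hnonneg_sum.trans hsum) (by exact_mod_cast hD))
  refine ⟨fun t => clampAround (2 ^ k) (xk t) (y t), ⟨⟨?_, fun t ht => ?_⟩, fun t ht => ?_,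
    fun z hz hzd => hcost.trans (hymin z hz hzd)⟩, fun t ht => ?_⟩
  · simp [clampAround, hx.1, hy.1]
  · have h1 := hx.2 t ht
    have h2 := hy.2 t ht
    simp only [clampAround]
    omega
  · have hlk' : 2 ^ l ∣ 2 ^ k := pow_dvd_pow 2 hlk.le
    have h1 := hlk'.trans (hxD t ht)
    have h2 : 2 ^ l ∣ max (y t) (xk t - 2 ^ k) := by
      rcases max_choice (y t) (xk t - 2 ^ k) with h | h <;> rw [h]
      exacts [hyd t ht, Nat.dvd_sub h1 hlk']
    simp only [clampAround]
    rcases min_choice (max (y t) (xk t - 2 ^ k)) (xk t + 2 ^ k) with h | h <;> rw [h]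
    exacts [h2, dvd_add h1 hlk']
  · have h : |(xk t : ℤ) - clampAround (2 ^ k) (xk t) (y t)| ≤ (2 ^ k : ℕ) := by
      rw [abs_le]
      simp only [clampAround]
      omega
    exact_mod_cast h
end
end

section
/- For every τ ∈ {1,…,T} and every optimal schedule X* = (x*_1,…,x*_T) for the discrete data-center optimization problem, the bounds x^L_τ ≤ x*_τ ≤ x^U_τ hold, where x^L_τ is the smallest final state of a minimizer of C^L_τ and x^U_τ is the largest final state of a minimizer of C^U_τ. -/
open Finset

noncomputable section

/-- Feasibility of a (truncated) schedule for time horizon `τ` with `m` servers: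
`x 0 = 0` and `x t ∈ {0, …, m}` for `t ∈ {1, …, τ}`. -/
def Feas (τ m : ℕ) (x : ℕ → ℕ) : Prop :=
  x 0 = 0 ∧ ∀ t ∈ Finset.Icc 1 τ, x t ≤ m

/-- `C^L_τ(X) = ∑_{t=1}^τ f_t(x_t) + β ∑_{t=1}^τ (x_t − x_{t−1})⁺`
(switching cost charged for powering up). -/
def CL (τ : ℕ) (β : ℝ) (f : ℕ → ℕ → ℝ) (x : ℕ → ℕ) : ℝ :=
  ∑ t ∈ Finset.Icc 1 τ, f t (x t)
    + β * ∑ t ∈ Finset.Icc 1 τ, max ((x t : ℝ) - (x (t - 1) : ℝ)) 0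

/-- `C^U_τ(X) = ∑_{t=1}^τ f_t(x_t) + β ∑_{t=1}^τ (x_{t−1} − x_t)⁺`
(switching cost charged for powering down). -/
def CU (τ : ℕ) (β : ℝ) (f : ℕ → ℕ → ℝ) (x : ℕ → ℕ) : ℝ :=
  ∑ t ∈ Finset.Icc 1 τ, f t (x t)
    + β * ∑ t ∈ Finset.Icc 1 τ, max ((x (t - 1) : ℝ) - (x t : ℝ)) 0

/-- The set of final states `x τ` of minimizers of `C^L_τ`. -/
def FinalL (τ m : ℕ) (β : ℝ) (f : ℕ → ℕ → ℝ) : Set ℕ :=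
  {n | ∃ x : ℕ → ℕ, Feas τ m x ∧ x τ = n ∧
    ∀ y : ℕ → ℕ, Feas τ m y → CL τ β f x ≤ CL τ β f y}

/-- The set of final states `x τ` of minimizers of `C^U_τ`. -/
def FinalU (τ m : ℕ) (β : ℝ) (f : ℕ → ℕ → ℝ) : Set ℕ :=
  {n | ∃ x : ℕ → ℕ, Feas τ m x ∧ x τ = n ∧
    ∀ y : ℕ → ℕ, Feas τ m y → CU τ β f x ≤ CU τ β f y}

theorem CL_succ (n : ℕ) (β : ℝ) (f : ℕ → ℕ → ℝ) (x : ℕ → ℕ) :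
    CL (n + 1) β f x =
      CL n β f x + f (n + 1) (x (n + 1)) + β * max ((x (n + 1) : ℝ) - (x n : ℝ)) 0 := by
  simp only [CL, Finset.sum_Icc_succ_top (Nat.le_add_left 1 n), Nat.add_sub_cancel]
  ring

/-- Along a schedule starting at `0`, power-ups exceed power-downs by the final state. -/
theorem CL_eq_CU_add (n : ℕ) (β : ℝ) (f : ℕ → ℕ → ℝ) {x : ℕ → ℕ} (hx : x 0 = 0) :
    CL n β f x = CU n β f x + β * (x n : ℝ) := by
  induction n with
  | zero => simp [CL, CU, hx]
  | succ n ih =>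
    have hU : CU (n + 1) β f x =
        CU n β f x + f (n + 1) (x (n + 1)) + β * max ((x n : ℝ) - (x (n + 1) : ℝ)) 0 := by
      simp only [CU, Finset.sum_Icc_succ_top (Nat.le_add_left 1 n), Nat.add_sub_cancel]
      ring
    have hpos : max ((x (n + 1) : ℝ) - (x n : ℝ)) 0 =
        max ((x n : ℝ) - (x (n + 1) : ℝ)) 0 + (x (n + 1) : ℝ) - (x n : ℝ) := by
      grind
    rw [CL_succ, hU, ih, hpos]
    ring

theorem max_sub_zero_submodular (a b c d : ℝ) :
    max (min a b - min c d) 0 + max (max a b - max c d) 0 ≤ max (a - c) 0 + max (b - d) 0 := by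
  grind

theorem CL_submodular (n : ℕ) {β : ℝ} (hβ : 0 ≤ β) (f : ℕ → ℕ → ℝ) (x y : ℕ → ℕ) :
    CL n β f (x ⊓ y) + CL n β f (x ⊔ y) ≤ CL n β f x + CL n β f y := by
  induction n with
  | zero => simp [CL]
  | succ n ih =>
    have hf : f (n + 1) ((x ⊓ y) (n + 1)) + f (n + 1) ((x ⊔ y) (n + 1)) =
        f (n + 1) (x (n + 1)) + f (n + 1) (y (n + 1)) := by
      rcases le_total (x (n + 1)) (y (n + 1)) with h | h
      · simp [h]
      · simp [h, add_comm]
    have hs := mul_le_mul_of_nonneg_left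
      (max_sub_zero_submodular (x (n + 1)) (y (n + 1)) (x n) (y n)) hβ
    simp only [CL_succ]
    simp only [Pi.inf_apply, Pi.sup_apply, Nat.cast_min, Nat.cast_max] at hf ⊢
    linarith

theorem CU_submodular (n : ℕ) {β : ℝ} (hβ : 0 ≤ β) (f : ℕ → ℕ → ℝ) {x y : ℕ → ℕ}
    (hx : x 0 = 0) (hy : y 0 = 0) :
    CU n β f (x ⊓ y) + CU n β f (x ⊔ y) ≤ CU n β f x + CU n β f y := by
  have h := CL_submodular n hβ f x y
  rw [CL_eq_CU_add n β f hx, CL_eq_CU_add n β f hy,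
    CL_eq_CU_add n β f (x := x ⊓ y) (by simp [hx]),
    CL_eq_CU_add n β f (x := x ⊔ y) (by simp [hx, hy])] at h
  have hsum : β * ((x ⊓ y) n : ℝ) + β * ((x ⊔ y) n : ℝ) = β * (x n : ℝ) + β * (y n : ℝ) := by
    rw [← mul_add, ← mul_add]
    simp only [Pi.inf_apply, Pi.sup_apply, Nat.cast_min, Nat.cast_max, min_add_max]
  linarith

theorem Feas.mono {τ T m : ℕ} {x : ℕ → ℕ} (h : Feas T m x) (hτ : τ ≤ T) : Feas τ m x :=
  ⟨h.1, fun t ht => h.2 t (Finset.Icc_subset_Icc_right hτ ht)⟩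

theorem Feas.inf {τ m : ℕ} {x y : ℕ → ℕ} (hx : Feas τ m x) (hy : Feas τ m y) :
    Feas τ m (x ⊓ y) :=
  ⟨by simp [hx.1, hy.1], fun t ht => inf_le_left.trans (hx.2 t ht)⟩

theorem Feas.sup {τ m : ℕ} {x y : ℕ → ℕ} (hx : Feas τ m x) (hy : Feas τ m y) :
    Feas τ m (x ⊔ y) :=
  ⟨by simp [hx.1, hy.1], fun t ht => sup_le (hx.2 t ht) (hy.2 t ht)⟩

/-- Follow `y` up to time `τ`, and `x` afterwards. -/
def splice (τ : ℕ) (y x : ℕ → ℕ) : ℕ → ℕ := fun t => if t ≤ τ then y t else x t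

theorem Feas.splice {τ T m : ℕ} {x y : ℕ → ℕ} (hy : Feas τ m y) (hx : Feas T m x) :
    Feas T m (splice τ y x) := by
  refine ⟨by simp [_root_.splice, hy.1], fun t ht => ?_⟩
  unfold _root_.splice
  split_ifs with h
  · exact hy.2 t (Finset.mem_Icc.2 ⟨(Finset.mem_Icc.1 ht).1, h⟩)
  · exact hx.2 t ht

theorem CL_splice_self (τ : ℕ) (β : ℝ) (f : ℕ → ℕ → ℝ) (y x : ℕ → ℕ) :
    CL τ β f (splice τ y x) = CL τ β f y := by
  have h : ∀ t ≤ τ, splice τ y x t = y t := fun t ht => if_pos ht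
  unfold CL
  congr 1
  · refine Finset.sum_congr rfl fun t ht => ?_
    rw [h t (Finset.mem_Icc.1 ht).2]
  · congr 1
    refine Finset.sum_congr rfl fun t ht => ?_
    rw [h t (Finset.mem_Icc.1 ht).2, h (t - 1) ((Nat.sub_le t 1).trans (Finset.mem_Icc.1 ht).2)]

/-- Replacing the first `τ` steps of `x` by `y` raises the later cost by at most that of powering
up from `y τ` to `x τ`. -/
theorem CL_splice_le {τ T : ℕ} (hT : τ ≤ T) {β : ℝ} (hβ : 0 ≤ β) (f : ℕ → ℕ → ℝ)
    (y x : ℕ → ℕ) :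
    CL T β f (splice τ y x) + CL τ β f x ≤
      CL T β f x + CL τ β f y + β * max ((x τ : ℝ) - (y τ : ℝ)) 0 := by
  suffices h : CL T β f (splice τ y x) + CL τ β f x
      + β * max ((x T : ℝ) - (splice τ y x T : ℝ)) 0 ≤
      CL T β f x + CL τ β f y + β * max ((x τ : ℝ) - (y τ : ℝ)) 0 from
    (le_add_of_nonneg_right (mul_nonneg hβ (le_max_right _ _))).trans h
  induction T, hT using Nat.le_induction with
  | base =>
    rw [CL_splice_self, show splice τ y x τ = y τ from if_pos le_rfl, add_comm (CL τ β f y)]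
  | succ n hn ih =>
    have hs : splice τ y x (n + 1) = x (n + 1) := if_neg (by omega)
    have htri : max ((x (n + 1) : ℝ) - (splice τ y x n : ℝ)) 0 ≤
        max ((x (n + 1) : ℝ) - (x n : ℝ)) 0 + max ((x n : ℝ) - (splice τ y x n : ℝ)) 0 := by
      grind
    have hβtri := mul_le_mul_of_nonneg_left htri hβ
    rw [mul_add] at hβtri
    rw [CL_succ, CL_succ, hs, sub_self, max_self, mul_zero]
    linarith

/-- For every `τ ∈ {1,…,T}` and every optimal schedule `X*`,
`x^L_τ ≤ x*_τ ≤ x^U_τ`, where `x^L_τ` is the smallest final state of a minimizer of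
`C^L_τ` and `x^U_τ` is the largest final state of a minimizer of `C^U_τ`. -/
theorem stmt4 (T m : ℕ) (β : ℝ) (hβ : 0 < β)
    (f : ℕ → ℕ → ℝ)
    (hconv : ∀ t ∈ Finset.Icc 1 T, ∀ a b : ℕ, a ≤ b → b + 1 ≤ m →
      f t (a + 1) - f t a ≤ f t (b + 1) - f t b)
    (hnonneg : ∀ t ∈ Finset.Icc 1 T, ∀ j : ℕ, j ≤ m → 0 ≤ f t j)
    (xL xU : ℕ → ℕ)
    (hxL : ∀ τ ∈ Finset.Icc 1 T, IsLeast (FinalL τ m β f) (xL τ))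
    (hxU : ∀ τ ∈ Finset.Icc 1 T, IsGreatest (FinalU τ m β f) (xU τ))
    (xstar : ℕ → ℕ) (hfeas : Feas T m xstar)
    (hopt : ∀ y : ℕ → ℕ, Feas T m y → CL T β f xstar ≤ CL T β f y) :
    ∀ τ ∈ Finset.Icc 1 T, xL τ ≤ xstar τ ∧ xstar τ ≤ xU τ := by
  intro τ hτ
  have hτT : τ ≤ T := (Finset.mem_Icc.1 hτ).2
  have hx := hfeas.mono hτT
  have key : ∀ y, Feas τ m y →
      CL τ β f xstar ≤ CL τ β f y + β * max ((xstar τ : ℝ) - (y τ : ℝ)) 0 := fun y hy => by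
    have h₁ := hopt _ (hy.splice hfeas)
    have h₂ := CL_splice_le hτT hβ.le f y xstar
    linarith
  constructor
  · obtain ⟨⟨z, hz, hzτ, hzmin⟩, hleast⟩ := hxL τ hτ
    by_contra! hlt
    have hmeet : CL τ β f z < CL τ β f (xstar ⊓ z) := by
      by_contra! hle
      have hmem : (xstar ⊓ z) τ ∈ FinalL τ m β f :=
        ⟨_, hx.inf hz, rfl, fun y hy => hle.trans (hzmin y hy)⟩
      exact absurd ((hleast hmem).trans inf_le_left) (not_le.2 hlt)
    have hjoin := key _ (hx.sup hz)
    have hle : (xstar τ : ℝ) ≤ ((xstar ⊔ z) τ : ℕ) :=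
      Nat.cast_le.2 (le_sup_left (a := xstar τ))
    rw [max_eq_right (sub_nonpos.2 hle)] at hjoin
    linarith [CL_submodular τ hβ.le f xstar z]
  · obtain ⟨⟨z, hz, hzτ, hzmin⟩, hgreatest⟩ := hxU τ hτ
    by_contra! hlt
    have hjoin : CU τ β f z < CU τ β f (xstar ⊔ z) := by
      by_contra! hle
      have hmem : (xstar ⊔ z) τ ∈ FinalU τ m β f :=
        ⟨_, hx.sup hz, rfl, fun y hy => hle.trans (hzmin y hy)⟩
      exact absurd ((le_sup_left (a := xstar τ)).trans (hgreatest hmem)) (not_le.2 hlt)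
    have hmeet := key _ (hx.inf hz)
    have hle : (((xstar ⊓ z) τ : ℕ) : ℝ) ≤ (xstar τ : ℝ) :=
      Nat.cast_le.2 (inf_le_left (a := xstar τ))
    rw [max_eq_left (sub_nonneg.2 hle), CL_eq_CU_add τ β f hx.1,
      CL_eq_CU_add τ β f (hx.inf hz).1] at hmeet
    linarith [CU_submodular τ hβ.le f hx.1 hz.1]
end
end

section
/- For every τ ∈ {1,…,T} and Y ∈ {L,U}, the function x ↦ Ĉ^Y_τ(x) on {0,…,m} is convex, i.e. Ĉ^Y_τ(x+1) − Ĉ^Y_τ(x) is nondecreasing in x for x ∈ {0,…,m−1}. -/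
open Finset

noncomputable section

/-- `Ĉ^L_τ(n)`: the minimal value of `C^L_τ` over feasible schedules whose final
state is `n`. -/
def hatCL (τ m : ℕ) (β : ℝ) (f : ℕ → ℕ → ℝ) (n : ℕ) : ℝ :=
  sInf {c : ℝ | ∃ x : ℕ → ℕ, Feas τ m x ∧ x τ = n ∧ c = CL τ β f x}

/-- `Ĉ^U_τ(n)`: the minimal value of `C^U_τ` over feasible schedules whose final
state is `n`. -/
def hatCU (τ m : ℕ) (β : ℝ) (f : ℕ → ℕ → ℝ) (n : ℕ) : ℝ :=
  sInf {c : ℝ | ∃ x : ℕ → ℕ, Feas τ m x ∧ x τ = n ∧ c = CU τ β f x}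

/-- Increments over a window of length `k` of a discretely convex function are nondecreasing. -/
theorem sub_le_sub_of_convex {m : ℕ} {g : ℕ → ℝ}
    (hg : ∀ a b : ℕ, a ≤ b → b + 1 ≤ m → g (a + 1) - g a ≤ g (b + 1) - g b)
    {a b : ℕ} (hab : a ≤ b) (k : ℕ) (hk : b + k ≤ m) :
    g (a + k) - g a ≤ g (b + k) - g b := by
  induction k with
  | zero => simp
  | succ k ih =>
    have h₁ := ih (by omega)
    have h₂ := hg (a + k) (b + k) (by omega) (by omega)
    simp only [← add_assoc]
    linarith

/-- A discretely convex function does not increase, in sum, when two points are replaced by the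
floor and the ceiling of their midpoint. -/
theorem floor_add_ceil_midpoint_le {m : ℕ} {g : ℕ → ℝ}
    (hg : ∀ a b : ℕ, a ≤ b → b + 1 ≤ m → g (a + 1) - g a ≤ g (b + 1) - g b)
    {x z : ℕ} (hx : x ≤ m) (hz : z ≤ m) :
    g ((x + z) / 2) + g ((x + z + 1) / 2) ≤ g x + g z := by
  wlog hxz : x ≤ z generalizing x z
  · rw [add_comm x z, add_comm (g x)]
    exact this hz hx (by omega)
  have h := sub_le_sub_of_convex hg (a := x) (b := (x + z + 1) / 2) (by omega)
    ((x + z) / 2 - x) (by omega)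
  rw [show x + ((x + z) / 2 - x) = (x + z) / 2 by omega,
    show (x + z + 1) / 2 + ((x + z) / 2 - x) = z by omega] at h
  linarith

/-- The positive part of the difference does not increase, in sum, when two pairs are replaced by
the floor and the ceiling of their midpoints. -/
theorem posPart_floor_add_ceil_midpoint_le (a b c d : ℕ) :
    max ((((a + c) / 2 : ℕ) : ℝ) - (((b + d) / 2 : ℕ) : ℝ)) 0
      + max ((((a + c + 1) / 2 : ℕ) : ℝ) - (((b + d + 1) / 2 : ℕ) : ℝ)) 0
      ≤ max ((a : ℝ) - (b : ℝ)) 0 + max ((c : ℝ) - (d : ℝ)) 0 := by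
  have h : max ((((a + c) / 2 : ℕ) : ℤ) - (((b + d) / 2 : ℕ) : ℤ)) 0
      + max ((((a + c + 1) / 2 : ℕ) : ℤ) - (((b + d + 1) / 2 : ℕ) : ℤ)) 0
      ≤ max ((a : ℤ) - (b : ℤ)) 0 + max ((c : ℤ) - (d : ℤ)) 0 := by
    omega
  exact_mod_cast h

/-- The minimal cost over schedules with a prescribed final state is convex in that state, for any
cost that is nonnegative and does not increase, in sum, when two schedules are replaced by the
floor and the ceiling of their midpoint. -/
theorem sInf_cost_convex {τ m : ℕ} (hτ : 1 ≤ τ) {C : (ℕ → ℕ) → ℝ}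
    (hC : ∀ x, Feas τ m x → 0 ≤ C x)
    (hmid : ∀ x z, Feas τ m x → Feas τ m z →
      C (fun t => (x t + z t) / 2) + C (fun t => (x t + z t + 1) / 2) ≤ C x + C z)
    {n : ℕ} (hn : n + 2 ≤ m) :
    sInf {c : ℝ | ∃ x : ℕ → ℕ, Feas τ m x ∧ x τ = n + 1 ∧ c = C x}
        - sInf {c : ℝ | ∃ x : ℕ → ℕ, Feas τ m x ∧ x τ = n ∧ c = C x}
      ≤ sInf {c : ℝ | ∃ x : ℕ → ℕ, Feas τ m x ∧ x τ = n + 2 ∧ c = C x}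
        - sInf {c : ℝ | ∃ x : ℕ → ℕ, Feas τ m x ∧ x τ = n + 1 ∧ c = C x} := by
  have hne (k : ℕ) (hk : k ≤ m) :
      {c : ℝ | ∃ x : ℕ → ℕ, Feas τ m x ∧ x τ = k ∧ c = C x}.Nonempty := by
    refine ⟨_, fun t => if t = 0 then 0 else k, ⟨rfl, fun t _ => ?_⟩, ?_, rfl⟩
    · dsimp only
      split_ifs <;> omega
    · exact if_neg (by omega)
  have hle (u : ℕ → ℕ) (hu : Feas τ m u) (hun : u τ = n + 1) :
      sInf {c : ℝ | ∃ x : ℕ → ℕ, Feas τ m x ∧ x τ = n + 1 ∧ c = C x} ≤ C u := by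
    refine csInf_le ⟨0, ?_⟩ ⟨u, hu, hun, rfl⟩
    rintro _ ⟨x, hx, -, rfl⟩
    exact hC x hx
  set M := sInf {c : ℝ | ∃ x : ℕ → ℕ, Feas τ m x ∧ x τ = n + 1 ∧ c = C x}
  have key (x z : ℕ → ℕ) (hx : Feas τ m x) (hz : Feas τ m z) (hxn : x τ = n)
      (hzn : z τ = n + 2) : M + M ≤ C x + C z := by
    refine (add_le_add (hle _ ⟨?_, fun t ht => ?_⟩ ?_) (hle _ ⟨?_, fun t ht => ?_⟩ ?_)).trans
      (hmid x z hx hz)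
    · simp [hx.1, hz.1]
    · have := hx.2 t ht
      have := hz.2 t ht
      omega
    · omega
    · simp [hx.1, hz.1]
    · have := hx.2 t ht
      have := hz.2 t ht
      omega
    · omega
  rw [sub_le_sub_iff, ← sub_le_iff_le_add]
  refine le_csInf (hne _ hn) ?_
  rintro _ ⟨z, hz, hzn, rfl⟩
  rw [sub_le_comm]
  refine le_csInf (hne _ (by omega)) ?_
  rintro _ ⟨x, hx, hxn, rfl⟩
  linarith [key x z hx hz hxn hzn]

/-- A sum of nonnegative convex operating costs and nonnegative switching costs has convex minimal
cost as a function of the final state, if the switching cost `d` does not increase, in sum, when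
two transitions are replaced by the floor and the ceiling of their midpoint. -/
theorem sInf_operating_add_switching_convex {τ m : ℕ} (hτ : 1 ≤ τ) {β : ℝ} (hβ : 0 ≤ β)
    {f : ℕ → ℕ → ℝ} {d : ℕ → ℕ → ℝ}
    (hconv : ∀ t ∈ Finset.Icc 1 τ, ∀ a b : ℕ, a ≤ b → b + 1 ≤ m →
      f t (a + 1) - f t a ≤ f t (b + 1) - f t b)
    (hnonneg : ∀ t ∈ Finset.Icc 1 τ, ∀ j : ℕ, j ≤ m → 0 ≤ f t j)
    (hd : ∀ a b, 0 ≤ d a b)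
    (hdmid : ∀ a b a' b', d ((a + a') / 2) ((b + b') / 2)
      + d ((a + a' + 1) / 2) ((b + b' + 1) / 2) ≤ d a b + d a' b')
    {C : (ℕ → ℕ) → ℝ}
    (hC : ∀ x, C x = ∑ t ∈ Finset.Icc 1 τ, f t (x t)
      + β * ∑ t ∈ Finset.Icc 1 τ, d (x t) (x (t - 1)))
    {n : ℕ} (hn : n + 2 ≤ m) :
    sInf {c : ℝ | ∃ x : ℕ → ℕ, Feas τ m x ∧ x τ = n + 1 ∧ c = C x}
        - sInf {c : ℝ | ∃ x : ℕ → ℕ, Feas τ m x ∧ x τ = n ∧ c = C x}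
      ≤ sInf {c : ℝ | ∃ x : ℕ → ℕ, Feas τ m x ∧ x τ = n + 2 ∧ c = C x}
        - sInf {c : ℝ | ∃ x : ℕ → ℕ, Feas τ m x ∧ x τ = n + 1 ∧ c = C x} := by
  refine sInf_cost_convex hτ (fun x hx => ?_) (fun x z hx hz => ?_) hn
  · rw [hC]
    exact add_nonneg (Finset.sum_nonneg fun t ht => hnonneg t ht _ (hx.2 t ht))
      (mul_nonneg hβ (Finset.sum_nonneg fun _ _ => hd _ _))
  · simp only [hC]
    rw [add_add_add_comm, add_add_add_comm (∑ t ∈ Finset.Icc 1 τ, f t (x t)),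
      ← mul_add, ← mul_add]
    simp only [← Finset.sum_add_distrib]
    exact add_le_add
      (Finset.sum_le_sum fun t ht =>
        floor_add_ceil_midpoint_le (hconv t ht) (hx.2 t ht) (hz.2 t ht))
      (mul_le_mul_of_nonneg_left (Finset.sum_le_sum fun t _ => hdmid _ _ _ _) hβ)

/-- For every `τ ∈ {1,…,T}` and `Y ∈ {L,U}`, the function
`x ↦ Ĉ^Y_τ(x)` is convex on `{0,…,m}`: its increments are nondecreasing. -/
theorem stmt6 (T m : ℕ) (β : ℝ) (hβ : 0 < β)
    (f : ℕ → ℕ → ℝ)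
    (hconv : ∀ t ∈ Finset.Icc 1 T, ∀ a b : ℕ, a ≤ b → b + 1 ≤ m →
      f t (a + 1) - f t a ≤ f t (b + 1) - f t b)
    (hnonneg : ∀ t ∈ Finset.Icc 1 T, ∀ j : ℕ, j ≤ m → 0 ≤ f t j) :
    ∀ τ ∈ Finset.Icc 1 T, ∀ n : ℕ, n + 2 ≤ m →
      (hatCL τ m β f (n + 1) - hatCL τ m β f n
          ≤ hatCL τ m β f (n + 2) - hatCL τ m β f (n + 1)) ∧
      (hatCU τ m β f (n + 1) - hatCU τ m β f n
          ≤ hatCU τ m β f (n + 2) - hatCU τ m β f (n + 1)) := by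
  intro τ hτ n hn
  obtain ⟨hτ1, hτT⟩ := Finset.mem_Icc.mp hτ
  have hsub := Finset.Icc_subset_Icc_right (a := 1) hτT
  have hconv' := fun t ht => hconv t (hsub ht)
  have hnonneg' := fun t ht => hnonneg t (hsub ht)
  exact ⟨sInf_operating_add_switching_convex hτ1 hβ.le hconv' hnonneg'
      (d := fun a b => max ((a : ℝ) - (b : ℝ)) 0) (fun _ _ => le_max_right _ _)
      (fun a b c d => posPart_floor_add_ceil_midpoint_le a b c d) (fun _ => rfl) hn,
    sInf_operating_add_switching_convex hτ1 hβ.le hconv' hnonneg'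
      (d := fun a b => max ((b : ℝ) - (a : ℝ)) 0) (fun _ _ => le_max_right _ _)
      (fun a b c d => posPart_floor_add_ceil_midpoint_le b a d c) (fun _ => rfl) hn⟩
end
end

section
/- Let X^LCP be the Lazy Capacity Provisioning schedule and let X* be the optimal schedule defined by the backward recursion x*_{T+1} = 0, x*_t = [x*_{t+1}]_{x^L_t}^{x^U_t}. Then the switching cost of LCP is at most the switching cost of X*: β Σ_{t=1}^T (x^LCP_t − x^LCP_{t−1})^+ ≤ β Σ_{t=1}^T (x*_t − x*_{t−1})^+ (with x^LCP_0 = x*_0 = 0). -/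
open Finset

noncomputable section

/-- Among all schedules that stay in the intervals `[a t, max (a t) (b t)]` and have the same start,
the one that is projected forward lazily has the least power-up movement; the slack is at least
the amount by which the other schedule ends above it. -/
theorem lazy_projection_upward_movement_le (T : ℕ) (a b x y : ℕ → ℕ) (h0 : y 0 = x 0)
    (hx : ∀ t ∈ Finset.Icc 1 T, x t = max (a t) (min (b t) (x (t - 1))))
    (hy : ∀ t ∈ Finset.Icc 1 T, a t ≤ y t ∧ y t ≤ max (a t) (b t)) :
    ∑ t ∈ Finset.Icc 1 T, (x t - x (t - 1)) + (y T - x T)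
      ≤ ∑ t ∈ Finset.Icc 1 T, (y t - y (t - 1)) := by
  induction T with
  | zero => simp [h0]
  | succ n ih =>
    have hsub : Finset.Icc 1 n ⊆ Finset.Icc 1 (n + 1) :=
      Finset.Icc_subset_Icc_right n.le_succ
    have hprev := ih (fun t ht => hx t (hsub ht)) fun t ht => hy t (hsub ht)
    have hmem : n + 1 ∈ Finset.Icc 1 (n + 1) := by simp
    have hxn := hx _ hmem
    have hyn := hy _ hmem
    rw [Finset.sum_Icc_succ_top (by omega), Finset.sum_Icc_succ_top (by omega)]
    simp only [Nat.add_sub_cancel] at hxn ⊢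
    omega

/-- The positive part of a difference of natural numbers is their truncated difference. -/
theorem max_natCast_sub_zero (p q : ℕ) : max ((p : ℝ) - (q : ℝ)) 0 = ((p - q : ℕ) : ℝ) := by
  rcases le_total q p with h | h
  · rw [Nat.cast_sub h, max_eq_left (sub_nonneg.mpr (Nat.cast_le.mpr h))]
  · rw [Nat.sub_eq_zero_of_le h, max_eq_right (sub_nonpos.mpr (Nat.cast_le.mpr h)), Nat.cast_zero]

/-- The switching cost of the LCP schedule is at most the switching
cost of the backwards-optimal schedule `X*`. -/
theorem stmt10 (T m : ℕ) (β : ℝ) (hβ : 0 < β)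
    (f : ℕ → ℕ → ℝ)
    (hconv : ∀ t ∈ Finset.Icc 1 T, ∀ a b : ℕ, a ≤ b → b + 1 ≤ m →
      f t (a + 1) - f t a ≤ f t (b + 1) - f t b)
    (hnonneg : ∀ t ∈ Finset.Icc 1 T, ∀ j : ℕ, j ≤ m → 0 ≤ f t j)
    (xL xU : ℕ → ℕ)
    (hxL : ∀ τ ∈ Finset.Icc 1 T, IsLeast (FinalL τ m β f) (xL τ))
    (hxU : ∀ τ ∈ Finset.Icc 1 T, IsGreatest (FinalU τ m β f) (xU τ))
    (xlcp : ℕ → ℕ) (hlcp0 : xlcp 0 = 0)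
    (hlcp : ∀ τ ∈ Finset.Icc 1 T, xlcp τ = max (xL τ) (min (xU τ) (xlcp (τ - 1))))
    (xstar : ℕ → ℕ) (hstar0 : xstar 0 = 0) (hstarT1 : xstar (T + 1) = 0)
    (hstar : ∀ t ∈ Finset.Icc 1 T, xstar t = max (xL t) (min (xU t) (xstar (t + 1)))) :
    β * ∑ t ∈ Finset.Icc 1 T, max ((xlcp t : ℝ) - (xlcp (t - 1) : ℝ)) 0
      ≤ β * ∑ t ∈ Finset.Icc 1 T, max ((xstar t : ℝ) - (xstar (t - 1) : ℝ)) 0 := by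
  refine mul_le_mul_of_nonneg_left ?_ hβ.le
  simp only [max_natCast_sub_zero]
  have key := lazy_projection_upward_movement_le T xL xU xlcp xstar (hstar0.trans hlcp0.symm) hlcp
    fun t ht => by
      have := hstar t ht
      omega
  exact_mod_cast (Nat.le_add_right _ _).trans key
end
end

section
/- In the randomized rounding scheme applied to a fractional schedule x̄_1,…,x̄_T, the marginal distribution at every time t ∈ {1,…,T} satisfies Pr[x_t = ⌊x̄_t⌋ + 1] = frac(x̄_t) and Pr[x_t = ⌊x̄_t⌋] = 1 − frac(x̄_t); in particular, if x̄_t is not an integer then Pr[x_t = ⌈x̄_t⌉] = frac(x̄_t). -/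
open Finset MeasureTheory

noncomputable section

/-- `frac x = x − ⌊x⌋`. -/
def fr (x : ℝ) : ℝ := x - (⌊x⌋₊ : ℝ)

/-- `x̄'_{t−1}`: the projection of the previous fractional state `x̄_{t−1}` into the
interval `[⌊x̄_t⌋, ⌈x̄_t⌉]`. -/
def projPrev (xbar : ℕ → ℝ) (t : ℕ) : ℝ :=
  max (⌊xbar t⌋₊ : ℝ) (min ((⌈xbar t⌉₊ : ℝ)) (xbar (t - 1)))

/-- `p↑_t = (x̄_t − x̄'_{t−1}) / (1 − frac(x̄'_{t−1}))`, where the fractional part of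
`x̄'_{t−1}` is taken relative to the interval `[⌊x̄_t⌋, ⌈x̄_t⌉]`, i.e. it equals
`x̄'_{t−1} − ⌊x̄_t⌋` (this coincides with `x̄'_{t−1} − ⌊x̄'_{t−1}⌋` except at the right
endpoint of the interval). -/
def pUp (xbar : ℕ → ℝ) (t : ℕ) : ℝ :=
  (xbar t - projPrev xbar t) / (1 - (projPrev xbar t - (⌊xbar t⌋₊ : ℝ)))

/-- `p↓_t = (x̄'_{t−1} − x̄_t) / frac(x̄'_{t−1})`, with the fractional part of
`x̄'_{t−1}` taken relative to the interval `[⌊x̄_t⌋, ⌈x̄_t⌉]` as in `pUp`. -/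
def pDown (xbar : ℕ → ℝ) (t : ℕ) : ℝ :=
  (projPrev xbar t - xbar t) / (projPrev xbar t - (⌊xbar t⌋₊ : ℝ))

/-- The variable `Y` rounds `x ≥ 0` to one of its two neighbouring naturals, and its law is
the one with mean `x`. -/
structure IsUnbiasedRounding {Ω : Type*} [MeasurableSpace Ω] (μ : Measure Ω)
    (Y : Ω → ℕ) (x : ℝ) : Prop where
  nonneg : 0 ≤ x
  range : ∀ ω, Y ω = ⌊x⌋₊ ∨ Y ω = ⌈x⌉₊
  upper : μ.real {ω | Y ω = ⌊x⌋₊ + 1} = fr x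
  lower : μ.real {ω | Y ω = ⌊x⌋₊} = 1 - fr x

theorem ceil_eq_floor_add_one_of_floor_ne {x : ℝ} (hx : 0 ≤ x) (h : (⌊x⌋₊ : ℝ) ≠ x) :
    ⌈x⌉₊ = ⌊x⌋₊ + 1 := by
  refine le_antisymm (Nat.ceil_le_floor_add_one x) (Nat.lt_ceil.2 ?_)
  exact lt_of_le_of_ne (Nat.floor_le hx) h

section Rounding

variable {Ω : Type*} [MeasurableSpace Ω] {μ : Measure Ω} [IsProbabilityMeasure μ]
  {Y Z : Ω → ℕ} {x y : ℝ}

theorem measureReal_ne_eq_one_sub (hY : Measurable Y) (n : ℕ) :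
    μ.real {ω | Y ω ≠ n} = 1 - μ.real {ω | Y ω = n} :=
  probReal_compl_eq_one_sub (hY (measurableSet_singleton n))

theorem IsUnbiasedRounding.of_floor_eq (hx : 0 ≤ x) (h : (⌊x⌋₊ : ℝ) = x)
    (hr : ∀ ω, Y ω = ⌊x⌋₊ ∨ Y ω = ⌈x⌉₊) : IsUnbiasedRounding μ Y x := by
  have hc : ⌈x⌉₊ = ⌊x⌋₊ := by
    conv_lhs => rw [← h]
    exact Nat.ceil_natCast _
  have hY : ∀ ω, Y ω = ⌊x⌋₊ := fun ω => by simpa [hc] using hr ω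
  exact ⟨hx, hr, by simp [hY, fr, h], by simp [hY, fr, h]⟩

theorem measureReal_floor_add_upper (hY : Measurable Y) (hx : 0 ≤ x) (h : (⌊x⌋₊ : ℝ) ≠ x)
    (hr : ∀ ω, Y ω = ⌊x⌋₊ ∨ Y ω = ⌈x⌉₊) :
    μ.real {ω | Y ω = ⌊x⌋₊} + μ.real {ω | Y ω = ⌊x⌋₊ + 1} = 1 := by
  have hs : {ω | Y ω = ⌊x⌋₊ + 1} = {ω | Y ω ≠ ⌊x⌋₊} := by
    ext ω
    have := hr ω
    have := ceil_eq_floor_add_one_of_floor_ne hx h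
    simp only [Set.mem_ofPred_eq]
    omega
  rw [hs, measureReal_ne_eq_one_sub hY]
  ring

theorem IsUnbiasedRounding.of_step_up (hY : IsUnbiasedRounding μ Y y)
    (hYm : Measurable Y) (hZm : Measurable Z) (hyx : y ≤ x) (h : (⌊x⌋₊ : ℝ) ≠ x)
    (hr : ∀ ω, Z ω = ⌊x⌋₊ ∨ Z ω = ⌈x⌉₊)
    (hkeep : ∀ ω, Y ω = ⌈x⌉₊ → Z ω = ⌈x⌉₊)
    (hprob : μ.real {ω | Y ω ≠ ⌈x⌉₊ ∧ Z ω = ⌈x⌉₊}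
      = (x - max (⌊x⌋₊ : ℝ) (min (⌈x⌉₊ : ℝ) y)) /
          (1 - (max (⌊x⌋₊ : ℝ) (min (⌈x⌉₊ : ℝ) y) - (⌊x⌋₊ : ℝ))) * μ.real {ω | Y ω ≠ ⌈x⌉₊}) :
    IsUnbiasedRounding μ Z x := by
  have hy := hY.nonneg
  have hx : 0 ≤ x := hy.trans hyx
  have hc := ceil_eq_floor_add_one_of_floor_ne hx h
  have hlt := Nat.lt_floor_add_one x
  have hle := Nat.floor_le hx
  rw [hc] at hprob hkeep
  rw [measureReal_ne_eq_one_sub hYm] at hprob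
  push_cast at hprob
  set p := max (⌊x⌋₊ : ℝ) (min ((⌊x⌋₊ : ℝ) + 1) y) with hp
  have hplt : p < ⌊x⌋₊ + 1 :=
    max_lt (by linarith) (lt_of_le_of_lt (min_le_right _ _) (by linarith))
  have hq : μ.real {ω | Y ω = ⌊x⌋₊ + 1} = p - ⌊x⌋₊ := by
    rcases le_or_gt (⌊x⌋₊ : ℝ) y with hny | hny
    · have hf : ⌊y⌋₊ = ⌊x⌋₊ := (Nat.floor_eq_iff hy).2 ⟨hny, by linarith⟩
      rw [hp, min_eq_right (by linarith), max_eq_right hny, ← hf]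
      exact hY.upper
    · have hcy : ⌈y⌉₊ ≤ ⌊x⌋₊ := Nat.ceil_le.2 hny.le
      have hs : {ω | Y ω = ⌊x⌋₊ + 1} = ∅ := by
        ext ω
        have := hY.range ω
        have := Nat.floor_le_ceil y
        simp only [Set.mem_ofPred_eq, Set.mem_empty_iff_false, iff_false]
        omega
      rw [hs, hp, max_eq_left ((min_le_right _ _).trans hny.le)]
      simp
  have hsplit : μ.real {ω | Z ω = ⌊x⌋₊ + 1} = μ.real {ω | Y ω = ⌊x⌋₊ + 1} +
      μ.real {ω | Y ω ≠ ⌊x⌋₊ + 1 ∧ Z ω = ⌊x⌋₊ + 1} := by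
    have hmeas : MeasurableSet {ω | Y ω = ⌊x⌋₊ + 1} := hYm (measurableSet_singleton _)
    rw [← measureReal_inter_add_sdiff (s := {ω | Z ω = ⌊x⌋₊ + 1}) hmeas]
    congr 2 <;> ext ω <;> have := hkeep ω <;>
      simp only [Set.mem_inter_iff, Set.mem_sdiff, Set.mem_ofPred_eq] <;> tauto
  have hup : μ.real {ω | Z ω = ⌊x⌋₊ + 1} = fr x := by
    rw [hsplit, hprob, hq, div_mul_cancel₀ _ (by linarith), fr]
    ring
  exact ⟨hx, hr, hup, by linarith [measureReal_floor_add_upper (μ := μ) hZm hx h hr]⟩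

theorem IsUnbiasedRounding.of_step_down (hY : IsUnbiasedRounding μ Y y)
    (hYm : Measurable Y) (hZm : Measurable Z) (hx : 0 ≤ x) (hxy : x < y)
    (h : (⌊x⌋₊ : ℝ) ≠ x)
    (hr : ∀ ω, Z ω = ⌊x⌋₊ ∨ Z ω = ⌈x⌉₊)
    (hkeep : ∀ ω, Y ω = ⌊x⌋₊ → Z ω = ⌊x⌋₊)
    (hprob : μ.real {ω | Y ω ≠ ⌊x⌋₊ ∧ Z ω = ⌊x⌋₊}
      = (max (⌊x⌋₊ : ℝ) (min (⌈x⌉₊ : ℝ) y) - x) /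
          (max (⌊x⌋₊ : ℝ) (min (⌈x⌉₊ : ℝ) y) - (⌊x⌋₊ : ℝ)) * μ.real {ω | Y ω ≠ ⌊x⌋₊}) :
    IsUnbiasedRounding μ Z x := by
  have hy := hY.nonneg
  have hlt := Nat.lt_floor_add_one x
  have hle := lt_of_le_of_ne (Nat.floor_le hx) h
  rw [ceil_eq_floor_add_one_of_floor_ne hx h, measureReal_ne_eq_one_sub hYm] at hprob
  push_cast at hprob
  set p := max (⌊x⌋₊ : ℝ) (min ((⌊x⌋₊ : ℝ) + 1) y) with hp
  have hplt : ⌊x⌋₊ < p := lt_max_of_lt_right (lt_min (by linarith) (by linarith))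
  have hq : μ.real {ω | Y ω = ⌊x⌋₊} = 1 - (p - ⌊x⌋₊) := by
    rcases lt_or_ge y (⌊x⌋₊ + 1 : ℝ) with hny | hny
    · have hf : ⌊y⌋₊ = ⌊x⌋₊ := (Nat.floor_eq_iff hy).2 ⟨by linarith, hny⟩
      rw [hp, min_eq_right hny.le, max_eq_right (by linarith), ← hf]
      exact hY.lower
    · have hfy : ⌊x⌋₊ + 1 ≤ ⌊y⌋₊ := Nat.le_floor (by exact_mod_cast hny)
      have hs : {ω | Y ω = ⌊x⌋₊} = ∅ := by
        ext ω
        have := hY.range ω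
        have := Nat.floor_le_ceil y
        simp only [Set.mem_ofPred_eq, Set.mem_empty_iff_false, iff_false]
        omega
      rw [hs, hp, min_eq_left hny, max_eq_right (by linarith)]
      simp
  have hsplit : μ.real {ω | Z ω = ⌊x⌋₊} = μ.real {ω | Y ω = ⌊x⌋₊} +
      μ.real {ω | Y ω ≠ ⌊x⌋₊ ∧ Z ω = ⌊x⌋₊} := by
    have hmeas : MeasurableSet {ω | Y ω = ⌊x⌋₊} := hYm (measurableSet_singleton _)
    rw [← measureReal_inter_add_sdiff (s := {ω | Z ω = ⌊x⌋₊}) hmeas]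
    congr 2 <;> ext ω <;> have := hkeep ω <;>
      simp only [Set.mem_inter_iff, Set.mem_sdiff, Set.mem_ofPred_eq] <;> tauto
  have hlow : μ.real {ω | Z ω = ⌊x⌋₊} = 1 - fr x := by
    rw [hsplit, hprob, hq, sub_sub_cancel, div_mul_cancel₀ _ (by linarith), fr]
    ring
  exact ⟨hx, hr, by linarith [measureReal_floor_add_upper (μ := μ) hZm hx h hr], hlow⟩

end Rounding

/-- In the randomized rounding scheme applied to a fractional schedule
`x̄_1,…,x̄_T`, the marginal distribution at every time `t ∈ {1,…,T}` satisfies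
`Pr[x_t = ⌊x̄_t⌋ + 1] = frac(x̄_t)` and `Pr[x_t = ⌊x̄_t⌋] = 1 − frac(x̄_t)`;
in particular, if `x̄_t` is not an integer then `Pr[x_t = ⌈x̄_t⌉] = frac(x̄_t)`.
The rounding scheme is described by the hypotheses: `X t ∈ {⌊x̄_t⌋, ⌈x̄_t⌉}`; on an
increasing step (`x̄_{t−1} ≤ x̄_t`) the upper state is kept, and from a lower state the
process moves up with probability `p↑_t`; on a decreasing step (`x̄_{t−1} > x̄_t`) the
lower state is kept, and from an upper state the process moves down with probability
`p↓_t`. -/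
theorem stmt14 {Ω : Type*} [MeasurableSpace Ω]
    (μ : Measure Ω) [IsProbabilityMeasure μ]
    (T m : ℕ) (xbar : ℕ → ℝ) (hx0 : xbar 0 = 0)
    (hxm : ∀ t ∈ Finset.Icc 1 T, xbar t ∈ Set.Icc (0 : ℝ) m)
    (X : ℕ → Ω → ℕ) (hX0 : ∀ ω, X 0 ω = 0) (hmeas : ∀ t, Measurable (X t))
    (hrange : ∀ t ∈ Finset.Icc 1 T, ∀ ω, X t ω = ⌊xbar t⌋₊ ∨ X t ω = ⌈xbar t⌉₊)
    (hkeepUp : ∀ t ∈ Finset.Icc 1 T, xbar (t - 1) ≤ xbar t →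
      ∀ ω, X (t - 1) ω = ⌈xbar t⌉₊ → X t ω = ⌈xbar t⌉₊)
    (hprobUp : ∀ t ∈ Finset.Icc 1 T, xbar (t - 1) ≤ xbar t →
      (⌊xbar t⌋₊ : ℝ) ≠ xbar t →
      (μ {ω | X (t - 1) ω ≠ ⌈xbar t⌉₊ ∧ X t ω = ⌈xbar t⌉₊}).toReal
        = pUp xbar t * (μ {ω | X (t - 1) ω ≠ ⌈xbar t⌉₊}).toReal)
    (hkeepDown : ∀ t ∈ Finset.Icc 1 T, xbar t < xbar (t - 1) →
      ∀ ω, X (t - 1) ω = ⌊xbar t⌋₊ → X t ω = ⌊xbar t⌋₊)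
    (hprobDown : ∀ t ∈ Finset.Icc 1 T, xbar t < xbar (t - 1) →
      (⌊xbar t⌋₊ : ℝ) ≠ xbar t →
      (μ {ω | X (t - 1) ω ≠ ⌊xbar t⌋₊ ∧ X t ω = ⌊xbar t⌋₊}).toReal
        = pDown xbar t * (μ {ω | X (t - 1) ω ≠ ⌊xbar t⌋₊}).toReal) :
    ∀ t ∈ Finset.Icc 1 T,
      (μ {ω | X t ω = ⌊xbar t⌋₊ + 1}).toReal = fr (xbar t) ∧
      (μ {ω | X t ω = ⌊xbar t⌋₊}).toReal = 1 - fr (xbar t) ∧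
      ((⌊xbar t⌋₊ : ℝ) ≠ xbar t →
        (μ {ω | X t ω = ⌈xbar t⌉₊}).toReal = fr (xbar t)) := by
  have key : ∀ t, t ≤ T → IsUnbiasedRounding μ (X t) (xbar t) := by
    intro t
    induction t with
    | zero =>
      intro _
      exact .of_floor_eq hx0.ge (by simp [hx0]) (by simp [hx0, hX0])
    | succ t ih =>
      intro ht
      have hmem : t + 1 ∈ Finset.Icc 1 T := Finset.mem_Icc.2 ⟨by omega, ht⟩
      have hpos := (hxm _ hmem).1
      have hr := hrange _ hmem
      by_cases h : (⌊xbar (t + 1)⌋₊ : ℝ) = xbar (t + 1)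
      · exact .of_floor_eq hpos h hr
      · rcases le_or_gt (xbar t) (xbar (t + 1)) with hle | hlt
        · exact (ih (by omega)).of_step_up (hmeas _) (hmeas _) hle h hr
            (hkeepUp _ hmem hle) (hprobUp _ hmem hle h)
        · exact (ih (by omega)).of_step_down (hmeas _) (hmeas _) hpos hlt h hr
            (hkeepDown _ hmem hlt) (hprobDown _ hmem hlt h)
  intro t ht
  have hround := key t (Finset.mem_Icc.1 ht).2
  refine ⟨hround.upper, hround.lower, fun h => ?_⟩
  rw [ceil_eq_floor_add_one_of_floor_ne hround.nonneg h]
  exact hround.upper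
end
end
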